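/- arXiv:2406.11215 — 3 statements merged into one kernel-verified Lean document; each statement's English description precedes it below -/
import Mathlib

section
/- For a given constant state (v*,u*) ∈ ℝ₊ × ℝ there exist positive constants δ₀, C, C₁, C₂ such that the following holds. Let U₋ = (v₋,u₋), U_m = (v_m,u_m), U₊ = (v₊,u₊) ∈ ℝ₊ × ℝ be any constants in the ball B_{δ₀}((v*,u*)) satisfying the Rankine–Hugoniot and Lax conditions with δ₁ := |p(v₋) − p(v_m)| < δ₀ and δ₂ := |p(v_m) − p(v₊)| < δ₀, and let (ṽ₁,ũ₁) and (ṽ₂,ũ₂) be the 1- and 2-viscous shocks connecting U₋ to U_m and U_m to U₊ respectively, normalized by ṽ₁(0) = (v₋+v_m)/2, ṽ₂(0) = (v_m+v₊)/2. Then for each i = 1,2 and all ξ ∈ ℝ: C⁻¹|ṽᵢ′(ξ)| ≤ |ũᵢ′(ξ)| ≤ C|ṽᵢ′(ξ)|; C⁻¹δᵢ² e^{−C₁δᵢ|ξ|} ≤ |ṽᵢ′(ξ)| ≤ Cδᵢ² e^{−C₂δᵢ|ξ|}; |(ṽᵢ″(ξ), ũᵢ″(ξ))| ≤ Cδᵢ|(ṽᵢ′(ξ),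 ũᵢ′(ξ))|; and |(ṽᵢ‴(ξ), ũᵢ‴(ξ))| ≤ Cδᵢ²|(ṽᵢ′(ξ), ũᵢ′(ξ))|. -/
noncomputable section
open MeasureTheory Set Filter Topology Real

namespace NS3D

abbrev Spc : Type := EuclideanSpace ℝ (Fin 3)

def e (i : Fin 3) : Spc := EuclideanSpace.single i 1

def PeriodicTD {F : Type*} (f : Spc → F) : Prop :=
  ∀ x : Spc, f (x + e 1) = f x ∧ f (x + e 2) = f x

def cell : Set Spc := {x : Spc | x 1 ∈ Icc (0:ℝ) 1 ∧ x 2 ∈ Icc (0:ℝ) 1}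
def cellP : Set Spc := {x : Spc | 0 < x 0 ∧ x 1 ∈ Icc (0:ℝ) 1 ∧ x 2 ∈ Icc (0:ℝ) 1}
def cellM : Set Spc := {x : Spc | x 0 < 0 ∧ x 1 ∈ Icc (0:ℝ) 1 ∧ x 2 ∈ Icc (0:ℝ) 1}
def cube : Set Spc := {x : Spc | x 0 ∈ Icc (0:ℝ) 1 ∧ x 1 ∈ Icc (0:ℝ) 1 ∧ x 2 ∈ Icc (0:ℝ) 1}

variable {F : Type*} [NormedAddCommGroup F] [NormedSpace ℝ F]

def L2Sq (s : Set Spc) (f : Spc → F) : ℝ := ∫ x in s, ‖f x‖^2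
def L2 (s : Set Spc) (f : Spc → F) : ℝ := Real.sqrt (L2Sq s f)
def MemL2 (s : Set Spc) (f : Spc → F) : Prop := IntegrableOn (fun x => ‖f x‖^2) s volume

def DSq (n : ℕ) (f : Spc → F) : ℝ := ∫ x in cell, ‖iteratedFDeriv ℝ n f x‖^2
def MemDSq (n : ℕ) (f : Spc → F) : Prop :=
  IntegrableOn (fun x => ‖iteratedFDeriv ℝ n f x‖^2) cell volume

def HSq (k : ℕ) (f : Spc → F) : ℝ := ∑ n ∈ Finset.range (k+1), DSq n f
def Hnorm (k : ℕ) (f : Spc → F) : ℝ := Real.sqrt (HSq k f)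
def MemH (k : ℕ) (f : Spc → F) : Prop := ∀ n, n ≤ k → MemDSq n f

def GradHSq (k : ℕ) (f : Spc → F) : ℝ := ∑ n ∈ Finset.Icc 1 (k+1), DSq n f
def GradHnorm (k : ℕ) (f : Spc → F) : ℝ := Real.sqrt (GradHSq k f)
def MemGradH (k : ℕ) (f : Spc → F) : Prop := ∀ n, 1 ≤ n → n ≤ k+1 → MemDSq n f

def ContHk (k : ℕ) (I : Set ℝ) (f : ℝ → Spc → F) : Prop :=
  (∀ t ∈ I, MemH k (f t)) ∧
  ∀ s ∈ I, Tendsto (fun t => HSq k (fun x => f t x - f s x)) (𝓝[I] s) (𝓝 (0:ℝ))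

def grad (f : Spc → ℝ) (x : Spc) : Spc :=
  (WithLp.equiv 2 (Fin 3 → ℝ)).symm (fun i => fderiv ℝ f x (e i))
def divg (u : Spc → Spc) (x : Spc) : ℝ := ∑ i, fderiv ℝ (fun y => u y i) x (e i)
def lap (f : Spc → ℝ) (x : Spc) : ℝ :=
  ∑ i, fderiv ℝ (fun y => fderiv ℝ f y (e i)) x (e i)
def vec3 (a b c : ℝ) : Spc := (WithLp.equiv 2 (Fin 3 → ℝ)).symm ![a, b, c]
def uvec (a : ℝ) : Spc := vec3 a 0 0
def curl (u : Spc → Spc) (x : Spc) : Spc :=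
  vec3 (fderiv ℝ (fun y => u y 2) x (e 1) - fderiv ℝ (fun y => u y 1) x (e 2))
       (fderiv ℝ (fun y => u y 0) x (e 2) - fderiv ℝ (fun y => u y 2) x (e 0))
       (fderiv ℝ (fun y => u y 1) x (e 0) - fderiv ℝ (fun y => u y 0) x (e 1))

def pfn (γ v : ℝ) : ℝ := v ^ (-γ)
def pderivfn (γ v : ℝ) : ℝ := -γ * v ^ (-γ - 1)
def Qfn (γ v : ℝ) : ℝ := v ^ (1 - γ) / (γ - 1)
def pRel (γ v w : ℝ) : ℝ := pfn γ v - pfn γ w - pderivfn γ w * (v - w)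
def QRel (γ v w : ℝ) : ℝ := Qfn γ v - Qfn γ w + pfn γ w * (v - w)

structure RHLax (γ σ1s σ2s vminus uminus vm um vplus uplus : ℝ) : Prop where
  posminus : 0 < vminus
  posm : 0 < vm
  posplus : 0 < vplus
  rh1v : -σ1s * (vm - vminus) = um - uminus
  rh1u : -σ1s * (um - uminus) + (pfn γ vm - pfn γ vminus) = 0
  lax1v : vm < vminus
  lax1u : um < uminus
  rh2v : -σ2s * (vplus - vm) = uplus - um
  rh2u : -σ2s * (uplus - um) + (pfn γ vplus - pfn γ vm) = 0
  lax2v : vm < vplus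
  lax2u : uplus < um

structure ViscousShock (γ μ lam σs vL uL vR uR : ℝ) (vt ut : ℝ → ℝ) : Prop where
  smooth_v : ContDiff ℝ 3 vt
  smooth_u : ContDiff ℝ 3 ut
  pos : ∀ ξ, 0 < vt ξ
  ode1 : ∀ ξ, -σs * deriv vt ξ = deriv ut ξ
  ode2 : ∀ ξ, -σs * deriv ut ξ + deriv (fun y => pfn γ (vt y)) ξ
            = (2*μ+lam) * deriv (deriv ut) ξ
  limL_v : Tendsto vt atBot (𝓝 vL)
  limL_u : Tendsto ut atBot (𝓝 uL)
  limR_v : Tendsto vt atTop (𝓝 vR)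
  limR_u : Tendsto ut atTop (𝓝 uR)

def heff (μ lam : ℝ) (vt ut : ℝ → ℝ) (ξ : ℝ) : ℝ := ut ξ - (2*μ+lam) * deriv vt ξ
def wgt (γ δ ν vm : ℝ) (vt : ℝ → ℝ) (ξ : ℝ) : ℝ := 1 + ν * (pfn γ vm - pfn γ (vt ξ)) / δ

def vcompY (c σ1 σ2 : ℝ) (f1 f2 : ℝ → ℝ) (t Y1 Y2 x1 : ℝ) : ℝ :=
  f1 (x1 - σ1*t - Y1) + f2 (x1 - σ2*t - Y2) - c
def acompY (γ vm σ1 σ2 δ1 δ2 ν1 ν2 : ℝ) (vt1 vt2 : ℝ → ℝ) (t Y1 Y2 x1 : ℝ) : ℝ :=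
  wgt γ δ1 ν1 vm vt1 (x1 - σ1*t - Y1) + wgt γ δ2 ν2 vm vt2 (x1 - σ2*t - Y2) - 1

def sigm (γ vm : ℝ) : ℝ := Real.sqrt (γ * vm ^ (-γ - 1))
def alpham (γ vm : ℝ) : ℝ := (γ + 1) / (2 * γ * sigm γ vm * pfn γ vm)
def Mconst (γ vm : ℝ) : ℝ := (5/4) * (sigm γ vm)^4 * vm^2 * alpham γ vm

def cutoff1 (σ1 σ2 t x1 : ℝ) : ℝ :=
  if x1 ≤ (3*σ1+σ2)/4 * t then 1
  else if (σ1+3*σ2)/4 * t ≤ x1 then 0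
  else ((σ1+3*σ2)/4 * t - x1) / ((σ1+3*σ2)/4 * t - (3*σ1+σ2)/4 * t)
def cutoff2 (σ1 σ2 t x1 : ℝ) : ℝ := 1 - cutoff1 σ1 σ2 t x1

def shiftF1 (γ μ lam vm σ1 σ2 σ1s δ1 δ2 ν1 ν2 M : ℝ) (vt1 ut1 vt2 : ℝ → ℝ)
    (v : ℝ → Spc → ℝ) (t Y1 Y2 : ℝ) : ℝ :=
  -(M/δ1) *
    ((∫ x in cell, (acompY γ vm σ1 σ2 δ1 δ2 ν1 ν2 vt1 vt2 t Y1 Y2 (x 0) / σ1s)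
        * deriv (heff μ lam vt1 ut1) (x 0 - σ1*t - Y1)
        * (pfn γ (v t x) - pfn γ (vcompY vm σ1 σ2 vt1 vt2 t Y1 Y2 (x 0))))
     - ∫ x in cell, acompY γ vm σ1 σ2 δ1 δ2 ν1 ν2 vt1 vt2 t Y1 Y2 (x 0)
        * deriv (fun y => pfn γ (vt1 y)) (x 0 - σ1*t - Y1)
        * (v t x - vcompY vm σ1 σ2 vt1 vt2 t Y1 Y2 (x 0)))
def shiftF2 (γ μ lam vm σ1 σ2 σ2s δ1 δ2 ν1 ν2 M : ℝ) (vt1 vt2 ut2 : ℝ → ℝ)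
    (v : ℝ → Spc → ℝ) (t Y1 Y2 : ℝ) : ℝ :=
  -(M/δ2) *
    ((∫ x in cell, (acompY γ vm σ1 σ2 δ1 δ2 ν1 ν2 vt1 vt2 t Y1 Y2 (x 0) / σ2s)
        * deriv (heff μ lam vt2 ut2) (x 0 - σ2*t - Y2)
        * (pfn γ (v t x) - pfn γ (vcompY vm σ1 σ2 vt1 vt2 t Y1 Y2 (x 0))))
     - ∫ x in cell, acompY γ vm σ1 σ2 δ1 δ2 ν1 ν2 vt1 vt2 t Y1 Y2 (x 0)
        * deriv (fun y => pfn γ (vt2 y)) (x 0 - σ2*t - Y2)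
        * (v t x - vcompY vm σ1 σ2 vt1 vt2 t Y1 Y2 (x 0)))

def ShiftODE (γ μ lam vm σ1 σ2 σ1s σ2s δ1 δ2 ν1 ν2 T : ℝ)
    (vt1 ut1 vt2 ut2 : ℝ → ℝ) (v : ℝ → Spc → ℝ) (X1 X2 dX1 dX2 : ℝ → ℝ) : Prop :=
  X1 0 = 0 ∧ X2 0 = 0 ∧
  ∀ t ∈ Icc 0 T,
    HasDerivAt X1 (dX1 t) t ∧ HasDerivAt X2 (dX2 t) t ∧
    dX1 t = shiftF1 γ μ lam vm σ1 σ2 σ1s δ1 δ2 ν1 ν2 (Mconst γ vm) vt1 ut1 vt2 v t (X1 t) (X2 t) ∧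
    dX2 t = shiftF2 γ μ lam vm σ1 σ2 σ2s δ1 δ2 ν1 ν2 (Mconst γ vm) vt1 vt2 ut2 v t (X1 t) (X2 t)

def NSvol (γ μ lam : ℝ) (I : Set ℝ) (v : ℝ → Spc → ℝ) (u : ℝ → Spc → Spc) : Prop :=
  (∀ t ∈ I, PeriodicTD (v t) ∧ PeriodicTD (u t)) ∧
  ∀ t ∈ I, ∀ x : Spc,
    0 < v t x ∧
    (1 / v t x) * (deriv (fun s => v s x) t + fderiv ℝ (v t) x (u t x)) = divg (u t) x ∧
    (1 / v t x) • (deriv (fun s => u s x) t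
        + (WithLp.equiv 2 (Fin 3 → ℝ)).symm (fun i => fderiv ℝ (fun y => u t y i) x (u t x)))
      + grad (fun y => pfn γ (v t y)) x
    = (2*μ+lam) • grad (fun y => divg (u t) y) x - μ • curl (curl (u t)) x

def NSdens (γ b μ lam : ℝ) (I : Set ℝ) (ρ : ℝ → Spc → ℝ) (u : ℝ → Spc → Spc) : Prop :=
  (∀ t ∈ I, PeriodicTD (ρ t) ∧ PeriodicTD (u t)) ∧
  ∀ t ∈ I, ∀ x : Spc,
    0 < ρ t x ∧
    (deriv (fun s => ρ s x) t + divg (fun y => ρ t y • u t y) x = 0) ∧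
    ∀ i : Fin 3,
      deriv (fun s => ρ s x * u s x i) t
        + divg (fun y => (ρ t y * u t y i) • u t y) x
        + fderiv ℝ (fun y => b * ρ t y ^ γ) x (e i)
      = μ * lap (fun y => u t y i) x
        + (μ+lam) * fderiv ℝ (fun y => divg (u t) y) x (e i)

structure RHLaxDens (γ b σ1 σ2 ρminus uminus ρm um ρplus uplus : ℝ) : Prop where
  posminus : 0 < ρminus
  posm : 0 < ρm
  posplus : 0 < ρplus
  rh1m : -σ1 * (ρm - ρminus) + (ρm * um - ρminus * uminus) = 0
  rh1mom : -σ1 * (ρm * um - ρminus * uminus) + (ρm * um^2 - ρminus * uminus^2)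
      + (b * ρm ^ γ - b * ρminus ^ γ) = 0
  lax1ρ : ρminus < ρm
  lax1u : um < uminus
  rh2m : -σ2 * (ρplus - ρm) + (ρplus * uplus - ρm * um) = 0
  rh2mom : -σ2 * (ρplus * uplus - ρm * um) + (ρplus * uplus^2 - ρm * um^2)
      + (b * ρplus ^ γ - b * ρm ^ γ) = 0
  lax2ρ : ρplus < ρm
  lax2u : uplus < um

structure ViscousShockDens (γ b μ lam σ ρL uL ρR uR : ℝ) (ρt ut : ℝ → ℝ) : Prop where
  smooth_ρ : ContDiff ℝ 3 ρt
  smooth_u : ContDiff ℝ 3 ut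
  pos : ∀ ξ, 0 < ρt ξ
  ode1 : ∀ ξ, -σ * deriv ρt ξ + deriv (fun y => ρt y * ut y) ξ = 0
  ode2 : ∀ ξ, -σ * deriv (fun y => ρt y * ut y) ξ + deriv (fun y => ρt y * (ut y)^2) ξ
        + deriv (fun y => b * ρt y ^ γ) ξ = (2*μ+lam) * deriv (deriv ut) ξ
  limL_ρ : Tendsto ρt atBot (𝓝 ρL)
  limL_u : Tendsto ut atBot (𝓝 uL)
  limR_ρ : Tendsto ρt atTop (𝓝 ρR)
  limR_u : Tendsto ut atTop (𝓝 uR)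


/-- Pointwise derivative estimates for a viscous shock of strength `δ`. -/
def ShockDerivEst (C C1 C2 δ : ℝ) (vt ut : ℝ → ℝ) : Prop :=
  ∀ ξ : ℝ,
    C⁻¹ * |deriv vt ξ| ≤ |deriv ut ξ| ∧
    |deriv ut ξ| ≤ C * |deriv vt ξ| ∧
    C⁻¹ * δ^2 * Real.exp (-C1 * δ * |ξ|) ≤ |deriv vt ξ| ∧
    |deriv vt ξ| ≤ C * δ^2 * Real.exp (-C2 * δ * |ξ|) ∧
    Real.sqrt ((deriv (deriv vt) ξ)^2 + (deriv (deriv ut) ξ)^2)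
      ≤ C * δ * Real.sqrt ((deriv vt ξ)^2 + (deriv ut ξ)^2) ∧
    Real.sqrt ((deriv (deriv (deriv vt)) ξ)^2 + (deriv (deriv (deriv ut)) ξ)^2)
      ≤ C * δ^2 * Real.sqrt ((deriv vt ξ)^2 + (deriv ut ξ)^2)

theorem aux_lin_pos (y c : ℝ → ℝ) (hc : Continuous c)
    (hy : ∀ t, HasDerivAt y (c t * y t) t) (h0 : 0 < y 0) (t : ℝ) : 0 < y t := by
  have hE : ∀ t, HasDerivAt (fun s => ∫ x in (0:ℝ)..s, c x) (c t) t := fun t =>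
    intervalIntegral.integral_hasDerivAt_right (hc.intervalIntegrable _ _)
      (hc.stronglyMeasurableAtFilter _ _) hc.continuousAt
  have hz : ∀ t, HasDerivAt (fun s => y s * Real.exp (-(∫ x in (0:ℝ)..s, c x))) 0 t := by
    intro t
    have := (hy t).mul ((hE t).neg.exp)
    exact this.congr_deriv (by ring)
  have hconst := is_const_of_deriv_eq_zero (fun t => (hz t).differentiableAt)
    (fun t => (hz t).deriv) t 0
  simp only [intervalIntegral.integral_same, neg_zero, Real.exp_zero, mul_one] at hconst
  have : 0 < y t * Real.exp (-(∫ x in (0:ℝ)..t, c x)) := by rw [hconst]; exact h0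
  exact pos_of_mul_pos_left this (Real.exp_pos _).le

theorem aux_lim_deriv (v : ℝ → ℝ) (l L : ℝ) (hv : Differentiable ℝ v)
    (h1 : Tendsto v atTop (𝓝 l)) (h2 : Tendsto (deriv v) atTop (𝓝 L)) : L = 0 := by
  have : ∀ x : ℝ, ∃ c ∈ Ioo x (x+1), deriv v c = (v (x+1) - v x) / (x + 1 - x) := fun x =>
    exists_deriv_eq_slope v (by linarith) hv.continuous.continuousOn hv.differentiableOn
  choose c hc hc' using this
  have hct : Tendsto c atTop atTop := tendsto_atTop_mono (fun x => (hc x).1.le) tendsto_id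
  have h3 : Tendsto (fun x => deriv v (c x)) atTop (𝓝 L) := h2.comp hct
  have h4 : Tendsto (fun x => v (x+1) - v x) atTop (𝓝 (l - l)) :=
    (h1.comp (tendsto_atTop_add_const_right _ 1 tendsto_id)).sub h1
  have h5 : (fun x => deriv v (c x)) = fun x => v (x+1) - v x := by
    funext x; rw [hc']; ring
  rw [h5] at h3
  have := tendsto_nhds_unique h3 h4
  simpa using this

theorem aux_convex (f f' f'' : ℝ → ℝ) (r R a d v : ℝ) (hr : r ≤ a) (ha : a < v) (hd : v < d)
    (hR : d ≤ R)
    (hf : ∀ x ∈ Icc r R, HasDerivAt f (f' x) x) (hf' : ∀ x ∈ Icc r R, HasDerivAt f' (f'' x) x)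
    (hn : ∀ x ∈ Icc r R, 0 ≤ f'' x) : (d - a) * f v ≤ (d - v) * f a + (v - a) * f d := by
  have hcv : ConvexOn ℝ (Icc r R) f := by
    refine convexOn_of_hasDerivWithinAt2_nonneg (convex_Icc r R)
      (fun x hx => (hf x hx).continuousAt.continuousWithinAt)
      (fun x hx => (hf x (interior_subset hx)).hasDerivWithinAt)
      (fun x hx => (hf' x (interior_subset hx)).hasDerivWithinAt)
      (fun x hx => hn x (interior_subset hx))
  have hda : 0 < d - a := by linarith
  have h := hcv.2 (⟨hr, by linarith⟩ : a ∈ Icc r R) (⟨by linarith, hR⟩ : d ∈ Icc r R)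
    (by apply div_nonneg <;> linarith : 0 ≤ (d - v)/(d-a))
    (by apply div_nonneg <;> linarith : 0 ≤ (v - a)/(d-a)) (by field_simp; ring)
  simp only [smul_eq_mul] at h
  have e1 : (d - v)/(d-a) * a + (v-a)/(d-a) * d = v := by field_simp; ring
  rw [e1] at h
  calc (d-a) * f v ≤ (d-a) * ((d - v) / (d - a) * f a + (v - a) / (d - a) * f d) := by gcongr
    _ = _ := by field_simp

/-- two-sided bound on the secant gap -/
theorem aux_secant (p p' p'' : ℝ → ℝ) (r R p2 P2 a d v s : ℝ) (hr : r ≤ a) (ha : a < v) (hd : v < d)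
    (hR : d ≤ R)
    (hf : ∀ x ∈ Icc r R, HasDerivAt p (p' x) x) (hf' : ∀ x ∈ Icc r R, HasDerivAt p' (p'' x) x)
    (hl : ∀ x ∈ Icc r R, p2 ≤ p'' x) (hu : ∀ x ∈ Icc r R, p'' x ≤ P2)
    (hs : s * (d - a) = p a - p d) :
    p2 / 2 * ((v - a) * (d - v)) ≤ -(s * (v - a) + p v - p a) ∧
    -(s * (v - a) + p v - p a) ≤ P2 / 2 * ((v - a) * (d - v)) := by
  have hda : 0 < d - a := by linarith
  have h1 := aux_convex (fun x => p x - p2/2 * x^2) (fun x => p' x - p2 * x) (fun x => p'' x - p2)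
    r R a d v hr ha hd hR
    (fun x hx => by
      exact ((hf x hx).sub (((hasDerivAt_pow 2 x)).const_mul (p2/2))).congr_deriv (by simp; ring))
    (fun x hx => by
      exact ((hf' x hx).sub (((hasDerivAt_id x)).const_mul (p2))).congr_deriv (by simp))
    (fun x hx => by linarith [hl x hx])
  have h2 := aux_convex (fun x => P2/2 * x^2 - p x) (fun x => P2 * x - p' x) (fun x => P2 - p'' x)
    r R a d v hr ha hd hR
    (fun x hx => by
      exact ((((hasDerivAt_pow 2 x)).const_mul (P2/2)).sub (hf x hx)).congr_deriv (by simp; ring))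
    (fun x hx => by
      exact ((((hasDerivAt_id x)).const_mul (P2)).sub (hf' x hx)).congr_deriv (by simp))
    (fun x hx => by linarith [hu x hx])
  have hpd : p d = p a - s * (d - a) := by linarith
  rw [hpd] at h1 h2
  constructor
  · refine le_of_mul_le_mul_left ?_ hda
    linarith
  · refine le_of_mul_le_mul_left ?_ hda
    linarith

theorem aux_log (L L' : ℝ → ℝ) (m M : ℝ) (hL : ∀ t, HasDerivAt L (L' t) t) (h0 : L 0 = 0)
    (hm : ∀ t, m ≤ L' t) (hM : ∀ t, L' t ≤ M) (hm0 : 0 ≤ m) (t : ℝ) :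
    m * |t| ≤ |L t| ∧ |L t| ≤ M * |t| := by
  have hd : Differentiable ℝ L := fun t => (hL t).differentiableAt
  have A : ∀ x y, x ≤ y → m * (y - x) ≤ L y - L x := fun x y hxy =>
    mul_sub_le_image_sub_of_le_deriv hd (fun t => by rw [(hL t).deriv]; exact hm t) hxy
  have B : ∀ x y, x ≤ y → L y - L x ≤ M * (y - x) := fun x y hxy =>
    image_sub_le_mul_sub_of_deriv_le hd (fun t => by rw [(hL t).deriv]; exact hM t) hxy
  rcases le_total 0 t with h | h
  · have a1 := A 0 t h
    have b1 := B 0 t h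
    rw [h0] at a1 b1
    have : 0 ≤ m * (t - 0) := by apply mul_nonneg hm0; linarith
    rw [abs_of_nonneg h, abs_of_nonneg (by linarith : 0 ≤ L t)]
    constructor <;> linarith
  · have a1 := A t 0 h
    have b1 := B t 0 h
    rw [h0] at a1 b1
    have : 0 ≤ m * (0 - t) := by apply mul_nonneg hm0; linarith
    rw [abs_of_nonpos h, abs_of_nonpos (by linarith : L t ≤ 0)]
    constructor <;> linarith

/-- profile bound: `ε w' = (w-a)(d-w) G`. -/
theorem aux_profile (w w' : ℝ → ℝ) (a d ε m M : ℝ) (hε : ε = 1 ∨ ε = -1) (had : a < d) (hm0 : 0 ≤ m)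
    (hw : ∀ t, HasDerivAt w (w' t) t) (ha : ∀ t, a < w t) (hd : ∀ t, w t < d)
    (h0 : w 0 = (a + d)/2)
    (hm : ∀ t, m * ((w t - a) * (d - w t)) ≤ ε * w' t)
    (hM : ∀ t, ε * w' t ≤ M * ((w t - a) * (d - w t))) (t : ℝ) :
    (d-a)^2/4 * Real.exp (-(M*(d-a)*|t|)) ≤ (w t - a) * (d - w t) ∧
    (w t - a) * (d - w t) ≤ (d-a)^2 * Real.exp (-(m*(d-a)*|t|)) := by
  have hL : ∀ t, HasDerivAt (fun t => ε * (Real.log (w t - a) - Real.log (d - w t)))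
      (ε * w' t * (d - a) / ((w t - a) * (d - w t))) t := by
    intro t
    have h1 := ((hw t).sub_const a).log (sub_pos.2 (ha t)).ne'
    have h2 := ((hw t).const_sub d).log (sub_pos.2 (hd t)).ne'
    refine ((h1.sub h2).const_mul ε).congr_deriv ?_
    have := (sub_pos.2 (ha t)).ne'
    have := (sub_pos.2 (hd t)).ne'
    field_simp
    ring
  have hda : 0 < d - a := by linarith
  have hX : ∀ t, 0 < (w t - a) * (d - w t) := fun t =>
    mul_pos (sub_pos.2 (ha t)) (sub_pos.2 (hd t))
  obtain ⟨l, u⟩ := aux_log _ _ (m * (d-a)) (M*(d-a)) hL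
    (by
      simp only [h0]
      have : (a+d)/2 - a = d - (a+d)/2 := by ring
      rw [this]; ring)
    (fun t => by rw [le_div_iff₀ (hX t)]; nlinarith [hm t])
    (fun t => by rw [div_le_iff₀ (hX t)]; nlinarith [hM t]) (by positivity) t
  have habs : |ε * (Real.log (w t - a) - Real.log (d - w t))|
      = |Real.log (w t - a) - Real.log (d - w t)| := by
    rcases hε with h | h <;> rw [h] <;> simp [abs_sub_comm]
  rw [habs] at l u
  have x1 : 0 < w t - a := sub_pos.2 (ha t)
  have x2 : 0 < d - w t := sub_pos.2 (hd t)
  have hsum : d - a = (w t - a) + (d - w t) := by ring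
  have key : ∀ x y : ℝ, 0 < x → x ≤ y → (x+y)^2/4 * Real.exp (-|Real.log x - Real.log y|) ≤ x * y ∧
      x * y ≤ (x+y)^2 * Real.exp (-|Real.log x - Real.log y|) := by
    intro x y hx hxy
    have hy : 0 < y := by linarith
    have : Real.exp (-|Real.log x - Real.log y|) = x / y := by
      rw [abs_of_nonpos (by linarith [Real.log_le_log hx hxy]), neg_neg, Real.exp_sub,
        Real.exp_log hx, Real.exp_log hy]
    rw [this]
    constructor
    · rw [← mul_div_assoc, div_le_iff₀ hy]
      have h1 : (x+y)^2/4 ≤ y*y := by nlinarith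
      nlinarith [mul_le_mul_of_nonneg_right h1 hx.le]
    · rw [← mul_div_assoc, le_div_iff₀ hy]
      nlinarith [mul_pos hx hy, mul_pos hx hx, mul_pos (mul_pos hx hy) hx, mul_pos (mul_pos hx hx) hx]
  have key2 : (d-a)^2/4 * Real.exp (-|Real.log (w t - a) - Real.log (d - w t)|) ≤ (w t - a) * (d - w t) ∧
      (w t - a) * (d - w t) ≤ (d-a)^2 * Real.exp (-|Real.log (w t - a) - Real.log (d - w t)|) := by
    rcases le_total (w t - a) (d - w t) with h | h
    · have := key _ _ x1 h
      rwa [← hsum] at this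
    · have := key _ _ x2 h
      rw [add_comm, ← hsum, abs_sub_comm, mul_comm (d - w t)] at this
      exact this
  constructor
  · refine le_trans ?_ key2.1
    gcongr
  · refine le_trans key2.2 ?_
    gcongr

theorem aux_range (p p' : ℝ → ℝ) (a d σ b : ℝ) (v : ℝ → ℝ) (ha : 0 < a) (had : a < d)
    (hb : b ≠ 0) (hσ : σ ≠ 0)
    (hf : ∀ x > 0, HasDerivAt p (p' x) x) (hv : Differentiable ℝ v) (hpos : ∀ t, 0 < v t)
    (hs : σ^2 * (d - a) = p a - p d)
    (hode : ∀ t, b * σ * deriv v t = -(σ^2 * (v t - a) + p (v t) - p a))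
    (h0 : v 0 = (a + d)/2) (t : ℝ) : a < v t ∧ v t < d := by
  have hbσ : b * σ ≠ 0 := mul_ne_zero hb hσ
  set h : ℝ → ℝ := fun x => σ^2 * (x - a) + p x - p a with hh
  have hha : h a = 0 := by simp [hh]
  have hhd : h d = 0 := by simp only [hh]; linarith
  have hhD : ∀ x > 0, DifferentiableAt ℝ h x := by
    intro x hx
    exact (((((hasDerivAt_id x).sub_const a).const_mul (σ^2)).add (hf x hx)).sub_const
      (p a)).differentiableAt
  have hhc : ContinuousOn h (Ioi 0) := fun x hx => (hhD x hx).continuousAt.continuousWithinAt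
  have hcont : ∀ e > 0, Continuous (fun t => -(dslope h e (v t)) / (b*σ)) := by
    intro e he
    have := (continuousOn_dslope (Ioi_mem_nhds he)).2 ⟨hhc, hhD e he⟩
    have h2 : Continuous (fun t => dslope h e (v t)) :=
      this.comp_continuous hv.continuous (fun t => hpos t)
    exact h2.neg.div_const _
  have hder : ∀ e > 0, h e = 0 → ∀ t, deriv v t = -(dslope h e (v t)) / (b*σ) * (v t - e) := by
    intro e he hhe t
    have h1 := sub_smul_dslope h e (v t)
    rw [hhe, smul_eq_mul, sub_zero] at h1
    have h2 := hode t
    have h3 : b * σ * deriv v t = -((v t - e) * dslope h e (v t)) := by rw [h1, h2]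
    field_simp
    linarith
  constructor
  · have := aux_lin_pos (fun t => v t - a) _ (hcont a ha)
      (fun t => ((hv t).hasDerivAt.sub_const a).congr_deriv (hder a ha hha t))
      (by simp only [h0]; linarith) t
    simpa using this
  · have hd : 0 < d := by linarith
    have := aux_lin_pos (fun t => d - v t) _ (hcont d hd)
      (fun t => ((hv t).hasDerivAt.const_sub d).congr_deriv (by rw [hder d hd hhd t]; ring))
      (by simp only [h0]; linarith) t
    simpa using this

theorem aux_core (p p' p'' : ℝ → ℝ) (r R p1 P1 p2 P2 b a d σ δ : ℝ) (v : ℝ → ℝ)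
    (hr : 0 < r) (hra : r ≤ a) (had : a < d) (hdR : d ≤ R) (hb : 0 < b) (hσ : σ ≠ 0)
    (hp1 : 0 < p1) (hp2 : 0 < p2)
    (hf : ∀ x > 0, HasDerivAt p (p' x) x) (hf' : ∀ x > 0, HasDerivAt p' (p'' x) x)
    (hl1 : ∀ x ∈ Icc r R, p1 ≤ -p' x) (hu1 : ∀ x ∈ Icc r R, -p' x ≤ P1)
    (hl2 : ∀ x ∈ Icc r R, p2 ≤ p'' x) (hu2 : ∀ x ∈ Icc r R, p'' x ≤ P2)
    (hv : ContDiff ℝ 3 v) (hpos : ∀ t, 0 < v t)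
    (hs : σ^2 * (d - a) = p a - p d) (hδ : δ = p a - p d)
    (hode : ∀ t, b * σ * deriv v t = -(σ^2 * (v t - a) + p (v t) - p a))
    (h0 : v 0 = (a + d)/2) (t : ℝ) :
    (√p1 ≤ |σ| ∧ |σ| ≤ √P1) ∧
    p2 / (8 * b * √P1 * P1^2) * δ^2 * Real.exp (-(P2 / (2 * b * √p1) / p1) * δ * |t|) ≤ |deriv v t| ∧
    |deriv v t| ≤ P2 / (2 * b * √p1 * p1^2) * δ^2 * Real.exp (-(p2 / (2 * b * √P1) / P1) * δ * |t|) ∧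
    |deriv (deriv v) t| ≤ P2 / (p1 * b * √p1) * δ * |deriv v t| ∧
    |deriv (deriv (deriv v)) t| ≤ (P2 * (P2 / (2 * b * √p1 * p1^2)) + P2 / p1 * (P2 / (p1 * b * √p1)))
      / (b * √p1) * δ^2 * |deriv v t| := by
  have hda : 0 < d - a := by linarith
  have hvd : Differentiable ℝ v := hv.differentiable (by norm_num)
  have hv2 : ContDiff ℝ 2 (deriv v) := by
    have : ContDiff ℝ (2+1) v := by convert hv using 1; norm_num
    exact (contDiff_succ_iff_deriv.1 this).2.2
  have hv1 : ContDiff ℝ 1 (deriv (deriv v)) := by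
    have : ContDiff ℝ (1+1) (deriv v) := by convert hv2 using 1; norm_num
    exact (contDiff_succ_iff_deriv.1 this).2.2
  have hvd2 : Differentiable ℝ (deriv v) := hv2.differentiable (by norm_num)
  have hvd3 : Differentiable ℝ (deriv (deriv v)) := hv1.differentiable (by norm_num)
  have hrg := aux_range p p' a d σ b v (by linarith) had hb.ne' hσ hf hvd hpos hs hode h0
  have hIcc : ∀ x ∈ Icc a d, x ∈ Icc r R := fun x hx => ⟨by linarith [hx.1], by linarith [hx.2]⟩
  have hvI : ∀ t, v t ∈ Icc a d := fun t => ⟨(hrg t).1.le, (hrg t).2.le⟩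
  have hposI : ∀ x ∈ Icc r R, 0 < x := fun x hx => by linarith [hx.1]
  -- sigma squared
  obtain ⟨θ, hθ, hθ'⟩ := exists_hasDerivAt_eq_slope p p' had
    (fun x hx => (hf x (hposI x (hIcc x hx))).continuousAt.continuousWithinAt)
    (fun x hx => hf x (hposI x (hIcc x ⟨hx.1.le, hx.2.le⟩)))
  have hθI : θ ∈ Icc a d := ⟨hθ.1.le, hθ.2.le⟩
  have hσθ : σ^2 = - p' θ := by
    rw [hθ']; field_simp; linarith
  have hσl : p1 ≤ σ^2 := by rw [hσθ]; exact hl1 _ (hIcc _ hθI)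
  have hσu : σ^2 ≤ P1 := by rw [hσθ]; exact hu1 _ (hIcc _ hθI)
  have hP1 : 0 < P1 := by linarith
  have hP2 : 0 < P2 := by linarith [hl2 _ (hIcc _ hθI), hu2 _ (hIcc _ hθI)]
  have hs1 : √p1 ≤ |σ| := by
    rw [← Real.sqrt_sq_eq_abs]; exact Real.sqrt_le_sqrt hσl
  have hS1 : |σ| ≤ √P1 := by
    rw [← Real.sqrt_sq_eq_abs]; exact Real.sqrt_le_sqrt hσu
  have hs0 : 0 < √p1 := Real.sqrt_pos.2 hp1
  have hS0 : 0 < √P1 := Real.sqrt_pos.2 hP1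
  have hσa : 0 < |σ| := abs_pos.2 hσ
  have hδD : δ = σ^2 * (d - a) := by rw [hδ, hs]
  have hδ0 : 0 < δ := by rw [hδD]; positivity
  have hDu : d - a ≤ δ / p1 := by
    rw [le_div_iff₀ hp1, hδD]; nlinarith
  have hDl : δ / P1 ≤ d - a := by
    rw [div_le_iff₀ hP1, hδD]; nlinarith
  -- sign
  obtain ⟨ε, hε, hεσ⟩ : ∃ ε : ℝ, (ε = 1 ∨ ε = -1) ∧ |σ| = ε * σ := by
    rcases lt_or_gt_of_ne hσ with h | h
    · exact ⟨-1, Or.inr rfl, by rw [abs_of_neg h]; ring⟩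
    · exact ⟨1, Or.inl rfl, by rw [abs_of_pos h]; ring⟩
  have hεε : ε * ε = 1 := by rcases hε with h | h <;> rw [h] <;> norm_num
  have hX : ∀ t, 0 < (v t - a) * (d - v t) := fun t =>
    mul_pos (sub_pos.2 (hrg t).1) (sub_pos.2 (hrg t).2)
  have hode' : ∀ t, b * |σ| * (ε * deriv v t) = -(σ^2 * (v t - a) + p (v t) - p a) := by
    intro t
    rw [← hode t, hεσ]
    linear_combination (b * σ * deriv v t) * hεε
  have hsec := fun t => aux_secant p p' p'' r R p2 P2 a d (v t) (σ^2) hra (hrg t).1 (hrg t).2 hdR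
    (fun x hx => hf x (hposI x hx)) (fun x hx => hf' x (hposI x hx)) hl2 hu2 hs
  have hlow : ∀ t, p2 / (2 * b * √P1) * ((v t - a) * (d - v t)) ≤ ε * deriv v t := by
    intro t
    have h1 := (hsec t).1
    rw [← hode' t] at h1
    have h2 : p2 / (2 * b * |σ|) * ((v t - a) * (d - v t)) ≤ ε * deriv v t := by
      rw [div_mul_eq_mul_div, div_le_iff₀ (by positivity)]
      linarith
    refine le_trans ?_ h2
    have := (hX t).le
    gcongr
  have hupp : ∀ t, ε * deriv v t ≤ P2 / (2 * b * √p1) * ((v t - a) * (d - v t)) := by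
    intro t
    have h1 := (hsec t).2
    rw [← hode' t] at h1
    have h2 : ε * deriv v t ≤ P2 / (2 * b * |σ|) * ((v t - a) * (d - v t)) := by
      rw [div_mul_eq_mul_div, le_div_iff₀ (by positivity)]
      linarith
    refine le_trans h2 ?_
    have := (hX t).le
    gcongr
  have hprof := aux_profile v (deriv v) a d ε _ _ hε had (by positivity) (fun t => (hvd t).hasDerivAt)
    (fun t => (hrg t).1) (fun t => (hrg t).2) h0 hlow hupp t
  have habs : |deriv v t| = ε * deriv v t := by
    have hp : 0 ≤ ε * deriv v t := le_trans (by have := hX t; positivity) (hlow t)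
    rw [← abs_of_nonneg hp, abs_mul]
    rcases hε with h | h <;> rw [h] <;> simp
  have hub : |deriv v t| ≤ P2 / (2 * b * √p1 * p1^2) * δ^2 * Real.exp (-(p2 / (2 * b * √P1) / P1) * δ * |t|) := by
    rw [habs]
    calc ε * deriv v t ≤ P2 / (2 * b * √p1) * ((v t - a) * (d - v t)) := hupp t
      _ ≤ P2 / (2 * b * √p1) * ((d-a)^2 * Real.exp (-(p2 / (2 * b * √P1)*(d-a)*|t|))) := by
        exact mul_le_mul_of_nonneg_left hprof.2 (by positivity)
      _ ≤ P2 / (2 * b * √p1) * ((δ/p1)^2 * Real.exp (-(p2 / (2 * b * √P1)*(δ/P1)*|t|))) := by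
        gcongr
      _ = _ := by
        have : -(p2 / (2 * b * √P1)*(δ/P1)*|t|) = -(p2 / (2 * b * √P1) / P1) * δ * |t| := by ring
        rw [this]; field_simp
  have hlb : p2 / (8 * b * √P1 * P1^2) * δ^2 * Real.exp (-(P2 / (2 * b * √p1) / p1) * δ * |t|) ≤ |deriv v t| := by
    rw [habs]
    calc _ = p2 / (2 * b * √P1) * ((δ/P1)^2/4 * Real.exp (-(P2 / (2 * b * √p1)*(δ/p1)*|t|))) := by
          have : -(P2 / (2 * b * √p1)*(δ/p1)*|t|) = -(P2 / (2 * b * √p1) / p1) * δ * |t| := by ring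
          rw [this]; field_simp; norm_num
      _ ≤ p2 / (2 * b * √P1) * ((d-a)^2/4 * Real.exp (-(P2 / (2 * b * √p1)*(d-a)*|t|))) := by
        gcongr
      _ ≤ p2 / (2 * b * √P1) * ((v t - a) * (d - v t)) := by
        exact mul_le_mul_of_nonneg_left hprof.1 (by positivity)
      _ ≤ _ := hlow t
  -- second derivative
  have hode2 : ∀ t, b * σ * deriv (deriv v) t = -((σ^2 + p' (v t)) * deriv v t) := by
    intro t
    have e1 : HasDerivAt (fun t => b * σ * deriv v t) (b * σ * deriv (deriv v) t) t :=
      (hvd2 t).hasDerivAt.const_mul _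
    have e2 : HasDerivAt (fun t => -(σ^2 * (v t - a) + p (v t) - p a))
        (-((σ^2 + p' (v t)) * deriv v t)) t := by
      have := (((((hvd t).hasDerivAt.sub_const a).const_mul (σ^2)).add
        ((hf (v t) (hpos t)).comp t (hvd t).hasDerivAt)).sub_const (p a)).neg
      exact this.congr_deriv (by ring)
    rw [← funext hode] at e2
    exact e1.unique e2
  have hode3 : b * σ * deriv (deriv (deriv v)) t
      = -((p'' (v t) * deriv v t) * deriv v t + (σ^2 + p' (v t)) * deriv (deriv v) t) := by
    have e1 : HasDerivAt (fun t => b * σ * deriv (deriv v) t) (b * σ * deriv (deriv (deriv v)) t) t :=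
      (hvd3 t).hasDerivAt.const_mul _
    have e2 : HasDerivAt (fun t => -((σ^2 + p' (v t)) * deriv v t))
        (-((p'' (v t) * deriv v t) * deriv v t + (σ^2 + p' (v t)) * deriv (deriv v) t)) t := by
      have := (((((hf' (v t) (hpos t)).comp t (hvd t).hasDerivAt)).const_add (σ^2)).mul
        (hvd2 t).hasDerivAt).neg
      exact this
    rw [← funext hode2] at e2
    exact e1.unique e2
  have hh' : |σ^2 + p' (v t)| ≤ P2 * (δ / p1) := by
    have h1 := (convex_Icc a d).norm_image_sub_le_of_norm_hasDerivWithin_le (f := p') (f' := p'')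
      (C := P2)
      (fun x hx => (hf' x (hposI x (hIcc x hx))).hasDerivWithinAt)
      (fun x hx => by
        rw [Real.norm_eq_abs, abs_of_nonneg (by linarith [hl2 x (hIcc x hx)])]
        exact hu2 x (hIcc x hx)) hθI (hvI t)
    rw [hσθ]
    rw [Real.norm_eq_abs, Real.norm_eq_abs] at h1
    have h2 : |v t - θ| ≤ d - a := by
      rw [abs_le]; constructor <;> linarith [hθ.1, hθ.2, (hvI t).1, (hvI t).2]
    have h3 : -p' θ + p' (v t) = p' (v t) - p' θ := by ring
    rw [h3]
    refine h1.trans ?_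
    gcongr
    exact h2.trans hDu
  have hdiv : ∀ x y : ℝ, b * σ * x = -y → |x| ≤ |y| / (b * √p1) := by
    intro x y h
    have h1 : b * |σ| * |x| = |y| := by
      rw [← abs_neg y, ← h, abs_mul, abs_mul, abs_of_pos hb]
    rw [le_div_iff₀ (by positivity), ← h1]
    have : |x| * (b * √p1) ≤ |x| * (b * |σ|) := by gcongr
    linarith
  have h2nd : |deriv (deriv v) t| ≤ P2 / (p1 * b * √p1) * δ * |deriv v t| := by
    refine (hdiv _ _ (hode2 t)).trans ?_
    rw [abs_mul]
    calc _ ≤ P2 * (δ / p1) * |deriv v t| / (b * √p1) := by gcongr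
      _ = _ := by field_simp
  have hub' : |deriv v t| ≤ P2 / (2 * b * √p1 * p1^2) * δ^2 := by
    refine hub.trans ?_
    apply mul_le_of_le_one_right (by positivity)
    rw [Real.exp_le_one_iff]
    have : 0 ≤ (p2 / (2 * b * √P1) / P1) * δ * |t| := by positivity
    linarith
  refine ⟨⟨hs1, hS1⟩, hlb, hub, h2nd, ?_⟩
  refine (hdiv _ _ hode3).trans ?_
  have hp''a : |p'' (v t)| ≤ P2 := by
    have := hIcc _ (hvI t)
    rw [abs_of_nonneg (by linarith [hl2 _ this])]
    exact hu2 _ this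
  calc |p'' (v t) * deriv v t * deriv v t + (σ ^ 2 + p' (v t)) * deriv (deriv v) t| / (b * √p1)
      ≤ (|p'' (v t)| * |deriv v t| * |deriv v t| + |σ ^ 2 + p' (v t)| * |deriv (deriv v) t|) / (b * √p1) := by
        gcongr
        refine (abs_add_le _ _).trans ?_
        simp only [abs_mul, le_refl]
    _ ≤ (P2 * (P2 / (2 * b * √p1 * p1^2) * δ^2) * |deriv v t| +
        (P2 * (δ / p1)) * (P2 / (p1 * b * √p1) * δ * |deriv v t|)) / (b * √p1) := by
        gcongr
    _ = _ := by ring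

theorem aux_est (C1 C2 S s A1 A2 A3 A4 σ δ : ℝ) (v u : ℝ → ℝ)
    (hs : 0 < s) (hS : 0 < S) (hA1 : 0 < A1) (hA2 : 0 < A2) (hA3 : 0 < A3) (hA4 : 0 < A4)
    (hδ : 0 ≤ δ)
    (hu : ∀ t, -σ * deriv v t = deriv u t)
    (H : ∀ t, (s ≤ |σ| ∧ |σ| ≤ S) ∧
      A2 * δ^2 * Real.exp (-C1 * δ * |t|) ≤ |deriv v t| ∧
      |deriv v t| ≤ A1 * δ^2 * Real.exp (-C2 * δ * |t|) ∧
      |deriv (deriv v) t| ≤ A3 * δ * |deriv v t| ∧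
      |deriv (deriv (deriv v)) t| ≤ A4 * δ^2 * |deriv v t|)
    (hv1 : Differentiable ℝ (deriv v)) (hv2 : Differentiable ℝ (deriv (deriv v))) :
    ShockDerivEst (S + s⁻¹ + A1 + A2⁻¹ + A3 + A4) C1 C2 δ v u := by
  have hu1 : deriv u = fun t => -σ * deriv v t := by funext t; rw [hu]
  have hu2 : deriv (deriv u) = fun t => -σ * deriv (deriv v) t := by
    funext t; rw [hu1]; exact deriv_const_mul _ (hv1 t)
  have hu3 : deriv (deriv (deriv u)) = fun t => -σ * deriv (deriv (deriv v)) t := by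
    funext t; rw [hu2]; exact deriv_const_mul _ (hv2 t)
  have hs' : 0 < s⁻¹ := by positivity
  have hA2' : 0 < A2⁻¹ := by positivity
  set C := S + s⁻¹ + A1 + A2⁻¹ + A3 + A4 with hC
  have hCp : 0 < C := by positivity
  have key : ∀ x : ℝ, √(x^2 + (-σ * x)^2) = √(1 + σ^2) * |x| := by
    intro x
    rw [← Real.sqrt_sq_eq_abs, ← Real.sqrt_mul (by positivity)]
    congr 1; ring
  intro t
  obtain ⟨⟨h1, h2⟩, h3, h4, h5, h6⟩ := H t
  rw [hu3, hu2, hu1]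
  simp only [key]
  rw [abs_mul, abs_neg]
  refine ⟨?_, ?_, ?_, ?_, ?_, ?_⟩
  · have : C⁻¹ ≤ s := inv_le_of_inv_le₀ hs (by linarith)
    have : C⁻¹ ≤ |σ| := this.trans h1
    gcongr
  · have : |σ| ≤ C := by linarith
    gcongr
  · refine le_trans ?_ h3
    have : C⁻¹ ≤ A2 := inv_le_of_inv_le₀ hA2 (by linarith)
    gcongr
  · refine le_trans h4 ?_
    have : A1 ≤ C := by linarith
    gcongr
  · have : A3 ≤ C := by linarith
    have h7 : |deriv (deriv v) t| ≤ C * δ * |deriv v t| := h5.trans (by gcongr)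
    calc _ ≤ √(1 + σ^2) * (C * δ * |deriv v t|) := by gcongr
      _ = _ := by ring
  · have : A4 ≤ C := by linarith
    have h7 : |deriv (deriv (deriv v)) t| ≤ C * δ^2 * |deriv v t| := h6.trans (by gcongr)
    calc _ ≤ √(1 + σ^2) * (C * δ^2 * |deriv v t|) := by gcongr
      _ = _ := by ring

theorem aux_hasDeriv_p (γ x : ℝ) (hx : 0 < x) : HasDerivAt (pfn γ) (pderivfn γ x) x :=
  Real.hasDerivAt_rpow_const (Or.inl hx.ne')

theorem aux_hasDeriv_p' (γ x : ℝ) (hx : 0 < x) :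
    HasDerivAt (pderivfn γ) (γ * (γ+1) * x ^ (-γ-2)) x := by
  have := (Real.hasDerivAt_rpow_const (x := x) (p := -γ-1) (Or.inl hx.ne')).const_mul (-γ)
  refine this.congr_deriv ?_
  rw [show -γ-1-1 = -γ-2 by ring]; ring

/-- once integrated ODE -/
theorem aux_ode (γ b σ vR uL uR vL : ℝ) (v u : ℝ → ℝ) (hσ : σ ≠ 0) (hb : b ≠ 0) (hv : ContDiff ℝ 3 v)
    (hpos : ∀ t, 0 < v t) (hR : 0 < vR)
    (ode1 : ∀ ξ, -σ * deriv v ξ = deriv u ξ)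
    (ode2 : ∀ ξ, -σ * deriv u ξ + deriv (fun y => pfn γ (v y)) ξ = b * deriv (deriv u) ξ)
    (lim : Tendsto v atTop (𝓝 vR)) (t : ℝ) :
    b * σ * deriv v t = -(σ^2 * (v t - vR) + pfn γ (v t) - pfn γ vR) := by
  have hvd : Differentiable ℝ v := hv.differentiable (by norm_num)
  have hv2 : ContDiff ℝ 2 (deriv v) := by
    have : ContDiff ℝ (2+1) v := by convert hv using 1; norm_num
    exact (contDiff_succ_iff_deriv.1 this).2.2
  have hvd2 : Differentiable ℝ (deriv v) := hv2.differentiable (by norm_num)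
  have hu1 : deriv u = fun t => -σ * deriv v t := by funext t; rw [ode1]
  have hu2 : deriv (deriv u) = fun t => -σ * deriv (deriv v) t := by
    funext t; rw [hu1]; exact deriv_const_mul _ (hvd2 t)
  have hp : ∀ t, HasDerivAt (fun y => pfn γ (v y)) (deriv (fun y => pfn γ (v y)) t) t := fun t =>
    ((aux_hasDeriv_p γ (v t) (hpos t)).comp t (hvd t).hasDerivAt).differentiableAt.hasDerivAt
  have hF : ∀ t, HasDerivAt (fun t => b * σ * deriv v t + σ^2 * v t + pfn γ (v t)) 0 t := by
    intro t
    refine ((((hvd2 t).hasDerivAt.const_mul (b*σ)).add ((hvd t).hasDerivAt.const_mul (σ^2))).add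
      (hp t)).congr_deriv ?_
    have := ode2 t
    rw [hu2, hu1] at this
    simp only at this
    linear_combination this
  have hconst := fun s => is_const_of_deriv_eq_zero (fun t => (hF t).differentiableAt)
    (fun t => (hF t).deriv) s t
  set K := b * σ * deriv v t + σ^2 * v t + pfn γ (v t) with hK
  have hd : deriv v = fun s => (K - σ^2 * v s - pfn γ (v s)) / (b*σ) := by
    funext s
    field_simp
    linear_combination hconst s
  have hlim : Tendsto (deriv v) atTop (𝓝 ((K - σ^2 * vR - pfn γ vR)/(b*σ))) := by
    rw [hd]
    have hpc : Tendsto (fun s => pfn γ (v s)) atTop (𝓝 (pfn γ vR)) :=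
      (aux_hasDeriv_p γ vR hR).continuousAt.tendsto.comp lim
    exact ((tendsto_const_nhds.sub (lim.const_mul _)).sub hpc).div_const _
  have h0 := aux_lim_deriv v _ _ hvd lim hlim
  have h1 : K - σ^2 * vR - pfn γ vR = 0 := by
    rcases div_eq_zero_iff.1 h0 with h | h
    · exact h
    · exact absurd h (mul_ne_zero hb hσ)
  rw [hK] at h1
  linear_combination h1

theorem aux_anti (r R x q : ℝ) (hr : 0 < r) (hx : x ∈ Icc r R) (hq : q ≤ 0) :
    R ^ q ≤ x ^ q ∧ x ^ q ≤ r ^ q :=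
  ⟨Real.rpow_le_rpow_of_nonpos (by linarith [hx.1]) hx.2 hq,
    Real.rpow_le_rpow_of_nonpos hr hx.1 hq⟩

theorem aux_single (γ b r R : ℝ) (hγ : 1 < γ) (hb : 0 < b) (hr : 0 < r) (hR : 0 < R) :
    ∃ C > 0, ∃ C1 > 0, ∃ C2 > 0, ∀ (a d σ δ : ℝ) (v u : ℝ → ℝ),
      r ≤ a → a < d → d ≤ R → σ ≠ 0 → ContDiff ℝ 3 v → (∀ t, 0 < v t) →
      σ^2 * (d - a) = pfn γ a - pfn γ d → δ = |pfn γ a - pfn γ d| →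
      (∀ t, b * σ * deriv v t = -(σ^2 * (v t - a) + pfn γ (v t) - pfn γ a)) →
      (∀ t, -σ * deriv v t = deriv u t) →
      v 0 = (a + d)/2 → ShockDerivEst C C1 C2 δ v u := by
  obtain ⟨p1, hp1, P1, hP1, h1⟩ : ∃ p1 > 0, ∃ P1 > 0, ∀ x ∈ Icc r R,
      p1 ≤ -pderivfn γ x ∧ -pderivfn γ x ≤ P1 := by
    refine ⟨γ * R ^ (-γ-1), by positivity, γ * r ^ (-γ-1), by positivity, fun x hx => ?_⟩
    obtain ⟨e1, e2⟩ := aux_anti r R x (-γ-1) hr hx (by linarith)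
    unfold pderivfn
    rw [show -(-γ * x ^ (-γ-1)) = γ * x ^ (-γ-1) by ring]
    constructor <;> gcongr
  obtain ⟨p2, hp2, P2, hP2, h2⟩ : ∃ p2 > 0, ∃ P2 > 0, ∀ x ∈ Icc r R,
      p2 ≤ γ * (γ+1) * x ^ (-γ-2) ∧ γ * (γ+1) * x ^ (-γ-2) ≤ P2 := by
    refine ⟨γ * (γ+1) * R ^ (-γ-2), by positivity, γ * (γ+1) * r ^ (-γ-2), by positivity,
      fun x hx => ?_⟩
    obtain ⟨e1, e2⟩ := aux_anti r R x (-γ-2) hr hx (by linarith)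
    constructor <;> gcongr
  have hs0 : 0 < √p1 := Real.sqrt_pos.2 hp1
  have hS0 : 0 < √P1 := Real.sqrt_pos.2 hP1
  refine ⟨√P1 + (√p1)⁻¹ + P2 / (2 * b * √p1 * p1^2) + (p2 / (8 * b * √P1 * P1^2))⁻¹
    + P2 / (p1 * b * √p1) + (P2 * (P2 / (2 * b * √p1 * p1^2)) + P2 / p1 * (P2 / (p1 * b * √p1)))
      / (b * √p1), by positivity, P2 / (2 * b * √p1) / p1, by positivity,
      p2 / (2 * b * √P1) / P1, by positivity, ?_⟩
  intro a d σ δ v u hra had hdR hσ hv hpos hs hδ hode hu h0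
  have hda : 0 < d - a := by linarith
  have hδ' : δ = pfn γ a - pfn γ d := by
    rw [hδ, abs_of_nonneg]; rw [← hs]; positivity
  have hδ0 : 0 ≤ δ := by rw [hδ]; positivity
  have hv2 : ContDiff ℝ 2 (deriv v) := by
    have : ContDiff ℝ (2+1) v := by convert hv using 1; norm_num
    exact (contDiff_succ_iff_deriv.1 this).2.2
  have hv1 : ContDiff ℝ 1 (deriv (deriv v)) := by
    have : ContDiff ℝ (1+1) (deriv v) := by convert hv2 using 1; norm_num
    exact (contDiff_succ_iff_deriv.1 this).2.2
  exact aux_est _ _ (√P1) (√p1) _ _ _ _ σ δ v u hs0 hS0 (by positivity) (by positivity)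
    (by positivity) (by positivity) hδ0 hu
    (fun t => aux_core (pfn γ) (pderivfn γ) (fun x => γ * (γ+1) * x ^ (-γ-2)) r R p1 P1 p2 P2 b a d
      σ δ v hr hra had hdR hb hσ hp1 hp2 (fun x hx => aux_hasDeriv_p γ x hx)
      (fun x hx => aux_hasDeriv_p' γ x hx) (fun x hx => (h1 x hx).1) (fun x hx => (h1 x hx).2)
      (fun x hx => (h2 x hx).1) (fun x hx => (h2 x hx).2) hv hpos hs hδ' hode h0 t)
    (hv2.differentiable (by norm_num)) (hv1.differentiable (by norm_num))

/-- Lemma 2.1: estimates on the viscous shock profiles. -/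
theorem viscous_shock_estimates
    (γ μ lam : ℝ) (hγ : 1 < γ) (hμ : 0 < μ) (hlam : 0 ≤ 2*μ + 3*lam)
    (vstar ustar : ℝ) (hvstar : 0 < vstar) :
    ∃ δ0 > 0, ∃ C > 0, ∃ C1 > 0, ∃ C2 > 0,
      ∀ (vminus uminus vm um vplus uplus σ1s σ2s δ1 δ2 : ℝ)
        (vt1 ut1 vt2 ut2 : ℝ → ℝ),
        (vminus - vstar)^2 + (uminus - ustar)^2 < δ0^2 →
        (vm - vstar)^2 + (um - ustar)^2 < δ0^2 →
        (vplus - vstar)^2 + (uplus - ustar)^2 < δ0^2 →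
        RHLax γ σ1s σ2s vminus uminus vm um vplus uplus →
        δ1 = |pfn γ vminus - pfn γ vm| → δ1 < δ0 →
        δ2 = |pfn γ vm - pfn γ vplus| → δ2 < δ0 →
        ViscousShock γ μ lam σ1s vminus uminus vm um vt1 ut1 →
        ViscousShock γ μ lam σ2s vm um vplus uplus vt2 ut2 →
        vt1 0 = (vminus + vm) / 2 → vt2 0 = (vm + vplus) / 2 →
        ShockDerivEst C C1 C2 δ1 vt1 ut1 ∧ ShockDerivEst C C1 C2 δ2 vt2 ut2 := by
  have hb : 0 < 2*μ+lam := by linarith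
  obtain ⟨C, hC, C1, hC1, C2, hC2, H⟩ := aux_single γ (2*μ+lam) (vstar/2) (3*vstar/2) hγ hb
    (by positivity) (by positivity)
  refine ⟨vstar/2, by positivity, C, hC, C1, hC1, C2, hC2, ?_⟩
  intro vminus uminus vm um vplus uplus σ1s σ2s δ1 δ2 vt1 ut1 vt2 ut2 hm hmm hp hRH hδ1 _ hδ2 _
    hV1 hV2 h01 h02
  have near : ∀ v u : ℝ, (v - vstar)^2 + (u - ustar)^2 < (vstar/2)^2 →
      vstar/2 ≤ v ∧ v ≤ 3*vstar/2 := by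
    intro v u h
    have h2 : (v - vstar)^2 < (vstar/2)^2 := by nlinarith [sq_nonneg (u - ustar)]
    have := abs_lt_of_sq_lt_sq h2 (by positivity)
    rw [abs_lt] at this
    constructor <;> linarith [this.1, this.2]
  have n1 := near _ _ hm
  have n2 := near _ _ hmm
  have n3 := near _ _ hp
  have hσ1 : σ1s ≠ 0 := by
    rintro h
    have := hRH.rh1v
    rw [h] at this
    linarith [hRH.lax1u]
  have hσ2 : σ2s ≠ 0 := by
    rintro h
    have := hRH.rh2v
    rw [h] at this
    linarith [hRH.lax2u]
  have s1 : σ1s^2 * (vminus - vm) = pfn γ vm - pfn γ vminus := by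
    have a1 := hRH.rh1v
    have a2 := hRH.rh1u
    rw [← a1] at a2
    linear_combination -a2
  have s2 : σ2s^2 * (vplus - vm) = pfn γ vm - pfn γ vplus := by
    have a1 := hRH.rh2v
    have a2 := hRH.rh2u
    rw [← a1] at a2
    linear_combination a2
  constructor
  · refine H vm vminus σ1s δ1 vt1 ut1 n2.1 hRH.lax1v n1.2 hσ1 hV1.smooth_v hV1.pos s1
      (by rw [hδ1, abs_sub_comm]) ?_ hV1.ode1 (by rw [h01, add_comm])
    exact aux_ode γ _ σ1s vm uminus um vminus vt1 ut1 hσ1 hb.ne' hV1.smooth_v hV1.pos hRH.posm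
      hV1.ode1 hV1.ode2 hV1.limR_v
  · refine H vm vplus σ2s δ2 vt2 ut2 n2.1 hRH.lax2v n3.2 hσ2 hV2.smooth_v hV2.pos s2 hδ2
      ?_ hV2.ode1 h02
    intro t
    have := aux_ode γ _ σ2s vplus um uplus vm vt2 ut2 hσ2 hb.ne' hV2.smooth_v hV2.pos hRH.posplus
      hV2.ode1 hV2.ode2 hV2.limR_v t
    linear_combination this + s2

end NS3D
end
end

section
/- For any c₁, c₂ > 0 there exists a constant C > 0 such that the following holds: for any T > 0 and any function v ∈ L^∞((0,T) × Ω) satisfying c₁ ≤ v(t,x) ≤ c₂ for all (t,x) ∈ [0,T] × Ω, the shift ODE system Ẋᵢ(t) = −(M/δᵢ)[∫_Ω (a^{X₁,X₂}/σᵢ*)(h̃ᵢ)_{x₁}^{Xᵢ}(p(v) − p(ṽ^{X₁,X₂})) dx − ∫_Ω a^{X₁,X₂} (p(ṽᵢ))_{x₁}^{Xᵢ}(v − ṽ^{X₁,X₂}) dx], Xᵢ(0) = 0 (i = 1,2), has a unique Lipschitz continuous solution (X₁,X₂) on [0,T]; moreover |X₁(t)| + |X₂(t)| ≤ Ct for all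 t ≤ T. -/
noncomputable section
open MeasureTheory Set Filter Topology Real

namespace NS3D

variable {F : Type*} [NormedAddCommGroup F] [NormedSpace ℝ F]

/-- A pair `(X1, X2)` is a Lipschitz (Carathéodory) solution of the shift ODE system
on `[0, T]`, in integral form. -/
def IsShiftSolOn (γ μ lam vm σ1 σ2 σ1s σ2s δ1 δ2 ν1 ν2 M T : ℝ)
    (vt1 ut1 vt2 ut2 : ℝ → ℝ) (v : ℝ → Spc → ℝ) (X1 X2 : ℝ → ℝ) : Prop :=
  (∃ K1 : NNReal, LipschitzOnWith K1 X1 (Icc 0 T)) ∧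
  (∃ K2 : NNReal, LipschitzOnWith K2 X2 (Icc 0 T)) ∧
  X1 0 = 0 ∧ X2 0 = 0 ∧
  ∀ t ∈ Icc 0 T,
    X1 t = ∫ s in (0:ℝ)..t, shiftF1 γ μ lam vm σ1 σ2 σ1s δ1 δ2 ν1 ν2 M vt1 ut1 vt2 v s (X1 s) (X2 s) ∧
    X2 t = ∫ s in (0:ℝ)..t, shiftF2 γ μ lam vm σ1 σ2 σ2s δ1 δ2 ν1 ν2 M vt1 vt2 ut2 v s (X1 s) (X2 s)


/-! ### Picard iteration for bounded, measurable-in-time, Lipschitz-in-space fields -/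

theorem picard_aux {E : Type*} [NormedAddCommGroup E] [NormedSpace ℝ E] [CompleteSpace E]
    (G : ℝ → E → E) (T B L : ℝ) (hT : 0 < T) (hL : 0 ≤ L)
    (hB : ∀ t ∈ Icc 0 T, ∀ y, ‖G t y‖ ≤ B)
    (hLip : ∀ t ∈ Icc 0 T, ∀ y z, ‖G t y - G t z‖ ≤ L * ‖y - z‖)
    (hm : ∀ X : ℝ → E, Continuous X → StronglyMeasurable (fun s => G s (X s))) :
    (∀ X : ℝ → E, ContinuousOn X (Icc 0 T) → ∀ a ∈ Icc 0 T, ∀ b ∈ Icc 0 T,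
      IntervalIntegrable (fun s => G s (X s)) volume a b) ∧
    ∃ X : ℝ → E, Continuous X ∧ (∀ t ∈ Icc 0 T, X t = ∫ s in (0:ℝ)..t, G s (X s)) ∧
      ∀ Y : ℝ → E, ContinuousOn Y (Icc 0 T) →
        (∀ t ∈ Icc 0 T, Y t = ∫ s in (0:ℝ)..t, G s (Y s)) → ∀ t ∈ Icc 0 T, Y t = X t := by
  have hint0 : ∀ X : ℝ → E, Continuous X → IntegrableOn (fun s => G s (X s)) (Icc 0 T) volume := by
    intro X hX
    refine Measure.integrableOn_of_bounded (M := B) (by simp)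
      (hm X hX).aestronglyMeasurable ?_
    filter_upwards [ae_restrict_mem measurableSet_Icc] with s hs
    exact hB s hs _
  have hint : ∀ X : ℝ → E, ContinuousOn X (Icc 0 T) → ∀ a ∈ Icc 0 T, ∀ b ∈ Icc 0 T,
      IntervalIntegrable (fun s => G s (X s)) volume a b := by
    intro X hX a ha b hb
    have h1 := hint0 (IccExtend hT.le ((Icc 0 T).domRestrict X)) (hX.domRestrict.Icc_extend' )
    have h2 : IntegrableOn (fun s => G s (X s)) (Icc 0 T) volume := by
      refine h1.congr_fun ?_ measurableSet_Icc
      intro s hs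
      simp [IccExtend_of_mem hT.le _ hs]
    refine (h2.mono_set (s := uIcc a b) ?_).intervalIntegrable
    exact uIcc_subset_Icc ha hb
  refine ⟨hint, ?_⟩
  set K : ℝ := 2 * L + 1 with hK
  have hKpos : 0 < K := by positivity
  have h0mem : (0:ℝ) ∈ Icc 0 T := ⟨le_refl _, hT.le⟩
  let ext : C(Icc (0:ℝ) T, E) → ℝ → E := fun Z s => Real.exp (K * s) • IccExtend hT.le Z s
  have hext : ∀ Z, Continuous (ext Z) := by
    intro Z
    exact (by fun_prop : Continuous fun s : ℝ => Real.exp (K * s)).smul Z.continuous.Icc_extend'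
  have hprim : ∀ X : ℝ → E, Continuous X →
      ContinuousOn (fun t => ∫ s in (0:ℝ)..t, G s (X s)) (Icc 0 T) := by
    intro X hX
    have := intervalIntegral.continuousOn_primitive_interval (f := fun s => G s (X s))
      (a := 0) (b := T) (μ := volume) (by rw [uIcc_of_le hT.le]; exact hint0 X hX)
    rwa [uIcc_of_le hT.le] at this
  let Φ : C(Icc (0:ℝ) T, E) → C(Icc (0:ℝ) T, E) := fun Z =>
    ⟨fun t => Real.exp (-(K * t)) • ∫ s in (0:ℝ)..t, G s (ext Z s), by
      refine Continuous.smul (by fun_prop) ?_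
      exact (hprim (ext Z) (hext Z)).domRestrict⟩
  have hcontr : ContractingWith (1/2) Φ := by
    refine ⟨by
      rw [← NNReal.coe_lt_coe]; norm_num, ?_⟩
    refine LipschitzWith.of_dist_le_mul ?_
    intro Z W
    rw [ContinuousMap.dist_le (by positivity)]
    rintro ⟨t, ht⟩
    have hle : ‖∫ s in (0:ℝ)..t, (G s (ext Z s) - G s (ext W s))‖ ≤
        ∫ s in (0:ℝ)..t, L * (Real.exp (K * s) * dist Z W) := by
      refine intervalIntegral.norm_integral_le_of_norm_le ht.1 ?_ ?_
      · refine Eventually.of_forall ?_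
        intro s hs
        have hs' : s ∈ Icc 0 T := ⟨hs.1.le, hs.2.trans ht.2⟩
        refine (hLip s hs' _ _).trans ?_
        refine mul_le_mul_of_nonneg_left ?_ hL
        simp only [ext]
        rw [← smul_sub, norm_smul, Real.norm_eq_abs, abs_of_pos (Real.exp_pos _)]
        refine mul_le_mul_of_nonneg_left ?_ (Real.exp_pos _).le
        rw [IccExtend_of_mem hT.le _ hs', IccExtend_of_mem hT.le _ hs', ← dist_eq_norm]
        exact ContinuousMap.dist_apply_le_dist _
      · exact (by fun_prop : Continuous fun s : ℝ =>
          L * (Real.exp (K * s) * dist Z W)).intervalIntegrable _ _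
    have hval : ∫ s in (0:ℝ)..t, L * (Real.exp (K * s) * dist Z W)
        = L * dist Z W / K * (Real.exp (K * t) - 1) := by
      have : ∀ x ∈ uIcc 0 t, HasDerivAt (fun s => L * dist Z W / K * Real.exp (K * s))
          (L * (Real.exp (K * x) * dist Z W)) x := by
        intro x _
        have h := (((hasDerivAt_id x).const_mul K).exp).const_mul (L * dist Z W / K)
        refine h.congr_deriv ?_
        simp only [id]
        field_simp
      rw [intervalIntegral.integral_eq_sub_of_hasDerivAt this
        ((by fun_prop : Continuous fun s : ℝ =>
          L * (Real.exp (K * s) * dist Z W)).intervalIntegrable _ _)]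
      simp; ring
    have hsub : dist (Φ Z ⟨t, ht⟩) (Φ W ⟨t, ht⟩) =
        Real.exp (-(K * t)) * ‖∫ s in (0:ℝ)..t, (G s (ext Z s) - G s (ext W s))‖ := by
      simp only [Φ, ContinuousMap.coe_mk]
      rw [dist_eq_norm, ← smul_sub, norm_smul, Real.norm_eq_abs, abs_of_pos (Real.exp_pos _),
        intervalIntegral.integral_sub (hint _ (hext Z).continuousOn 0 h0mem t ht)
          (hint _ (hext W).continuousOn 0 h0mem t ht)]
    rw [hsub]
    rw [hval] at hle
    have he : Real.exp (-(K * t)) * Real.exp (K * t) = 1 := by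
      rw [← Real.exp_add]; simp
    have hd : 0 ≤ dist Z W := dist_nonneg
    have hLK : L / K ≤ 1/2 := by
      rw [div_le_div_iff₀ hKpos (by norm_num)]; linarith
    calc _ ≤ Real.exp (-(K * t)) * (L * dist Z W / K * (Real.exp (K * t) - 1)) :=
          mul_le_mul_of_nonneg_left hle (Real.exp_pos _).le
      _ = L / K * dist Z W * (Real.exp (-(K * t)) * Real.exp (K * t) - Real.exp (-(K * t))) := by
          ring
      _ ≤ L / K * dist Z W * 1 := by
          refine mul_le_mul_of_nonneg_left ?_ (by positivity)
          rw [he]; linarith [Real.exp_pos (-(K * t))]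
      _ ≤ 1/2 * dist Z W := by
          rw [mul_one]; exact mul_le_mul_of_nonneg_right hLK hd
      _ = _ := by norm_num
  have hee : ∀ t : ℝ, Real.exp (K * t) * Real.exp (-(K * t)) = 1 := by
    intro t; rw [← Real.exp_add]; simp
  let Z := ContractingWith.fixedPoint Φ hcontr
  have hZ : Φ Z = Z := hcontr.fixedPoint_isFixedPt
  refine ⟨ext Z, hext Z, ?_, ?_⟩
  · intro t ht
    have h := congrArg (fun W : C(Icc (0:ℝ) T, E) => W ⟨t, ht⟩) hZ
    simp only [Φ, ContinuousMap.coe_mk] at h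
    change Real.exp (K * t) • IccExtend hT.le Z t = _
    rw [IccExtend_of_mem hT.le _ ht, ← h, smul_smul, hee, one_smul]
  · intro Y hY hYeq t ht
    let W : C(Icc (0:ℝ) T, E) := ⟨fun t => Real.exp (-(K * t)) • Y t,
      Continuous.smul (by fun_prop) hY.domRestrict⟩
    have hWY : ∀ s ∈ Icc 0 T, ext W s = Y s := by
      intro s hs
      change Real.exp (K * s) • IccExtend hT.le W s = _
      rw [IccExtend_of_mem hT.le _ hs]
      simp only [W, ContinuousMap.coe_mk]
      rw [smul_smul, hee, one_smul]
    have hW : Φ W = W := by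
      ext ⟨s, hs⟩
      simp only [Φ, W, ContinuousMap.coe_mk]
      congr 1
      rw [hYeq s hs]
      refine intervalIntegral.integral_congr ?_
      intro r hr
      rw [uIcc_of_le hs.1] at hr
      have hr' : r ∈ Icc 0 T := ⟨hr.1, hr.2.trans hs.2⟩
      have := hWY r hr'
      simp only [W] at this
      simp only [this]
    have hWZ : W = Z := hcontr.fixedPoint_unique hW
    rw [← hWY t ht, hWZ]

/-! ### Integration over the cell of functions of the first variable -/

theorem measurableSet_cell : MeasurableSet cell := by
  have h1 : Measurable fun x : Spc => x 1 := by fun_prop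
  have h2 : Measurable fun x : Spc => x 2 := by fun_prop
  exact (h1 measurableSet_Icc).inter (h2 measurableSet_Icc)

theorem map_cell : MeasurePreserving (fun x : Spc => x 0) (volume.restrict cell) volume := by
  have h0 : Measurable fun x : Spc => x 0 := by fun_prop
  refine ⟨h0, ?_⟩
  ext s hs
  rw [Measure.map_apply h0 hs, Measure.restrict_apply (h0 hs)]
  have hset : (fun x : Spc => x 0) ⁻¹' s ∩ cell =
      (@WithLp.ofLp 2 (Fin 3 → ℝ)) ⁻¹' (Set.univ.pi ![s, Icc 0 1, Icc 0 1]) := by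
    ext x
    simp [cell, Fin.forall_fin_succ]
  rw [hset, (PiLp.volume_preserving_ofLp (Fin 3)).measure_preimage (MeasurableSet.univ_pi (by
      intro i; fin_cases i <;> simp [hs])).nullMeasurableSet, volume_pi_pi]
  simp [Fin.prod_univ_succ]

/-- `L¹` translation estimate. -/
theorem translate_L1 (k k' : ℝ → ℝ) (hd : ∀ x, HasDerivAt k (k' x) x) (hc : Continuous k')
    (hi : Integrable k') (a b : ℝ) :
    Integrable (fun x => k (x - a) - k (x - b)) ∧
      ∫ x, |k (x - a) - k (x - b)| ≤ (∫ x, |k' x|) * |a - b| := by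
  have hkc : Continuous k := continuous_iff_continuousAt.2 fun x => (hd x).continuousAt
  have key : ∫⁻ x, ‖k (x - a) - k (x - b)‖ₑ ≤ ENNReal.ofReal ((∫ x, |k' x|) * |a - b|) := by
    have h1 : ∀ x, ‖k (x - a) - k (x - b)‖ₑ ≤ ∫⁻ s in uIoc a b, ‖k' (x - s)‖ₑ := by
      intro x
      have hFTC : ∫ s in b..a, -k' (x - s) = k (x - a) - k (x - b) := by
        refine intervalIntegral.integral_eq_sub_of_hasDerivAt (f := fun s => k (x - s)) ?_ ?_
        · intro s _
          have := (hd (x - s)).comp s ((hasDerivAt_id s).const_sub x)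
          simpa [Function.comp_def] using this
        · exact (by fun_prop : Continuous fun s => -k' (x - s)).intervalIntegrable _ _
      rw [← hFTC, ← ofReal_norm, intervalIntegral.norm_intervalIntegral_eq,
        ofReal_norm, uIoc_comm]
      refine (enorm_integral_le_lintegral_enorm _).trans ?_
      simp
    have h2 : ∫⁻ x, ‖k' x‖ₑ = ENNReal.ofReal (∫ x, |k' x|) := by
      have := ofReal_integral_norm_eq_lintegral_enorm hi
      simpa using this.symm
    calc _ ≤ ∫⁻ x, ∫⁻ s in uIoc a b, ‖k' (x - s)‖ₑ := lintegral_mono h1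
      _ = ∫⁻ s in uIoc a b, ∫⁻ x, ‖k' (x - s)‖ₑ := by
          refine lintegral_lintegral_swap ?_
          have hcc : Continuous fun p : ℝ × ℝ => k' (p.1 - p.2) := hc.comp (by fun_prop)
          exact hcc.measurable.enorm.aemeasurable
      _ = ∫⁻ s in uIoc a b, ENNReal.ofReal (∫ x, |k' x|) := by
          refine lintegral_congr ?_
          intro s
          rw [← h2]
          exact lintegral_sub_right_eq_self (fun x => ‖k' x‖ₑ) s
      _ = _ := by
          rw [lintegral_const, Measure.restrict_apply_univ, Real.volume_uIoc, ENNReal.ofReal_mul (by positivity), abs_sub_comm]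
  have hint : Integrable (fun x => k (x - a) - k (x - b)) := by
    refine ⟨by fun_prop, ?_⟩
    exact lt_of_le_of_lt key ENNReal.ofReal_lt_top
  refine ⟨hint, ?_⟩
  have h3 := ofReal_integral_norm_eq_lintegral_enorm hint
  rw [← h3] at key
  rw [ENNReal.ofReal_le_ofReal_iff (by positivity)] at key
  simpa using key

/-- Bounded, Lipschitz in the parameter, measurable in space. -/
def BL (M L : ℝ) (f : ℝ × ℝ → Spc → ℝ) : Prop :=
  (∀ Y, Measurable (f Y)) ∧ (∀ Y x, |f Y x| ≤ M) ∧ ∀ Y Z x, |f Y x - f Z x| ≤ L * ‖Y - Z‖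

theorem BL.mul {M L M' L' : ℝ} {f g : ℝ × ℝ → Spc → ℝ} (hf : BL M L f) (hg : BL M' L' g) :
    BL (M * M') (M * L' + L * M') (fun Y x => f Y x * g Y x) := by
  refine ⟨fun Y => (hf.1 Y).mul (hg.1 Y), fun Y x => ?_, fun Y Z x => ?_⟩
  · rw [abs_mul]
    exact mul_le_mul (hf.2.1 Y x) (hg.2.1 Y x) (abs_nonneg _) ((abs_nonneg _).trans (hf.2.1 Y x))
  · have : f Y x * g Y x - f Z x * g Z x
        = f Y x * (g Y x - g Z x) + (f Y x - f Z x) * g Z x := by ring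
    rw [this]
    refine (abs_add_le _ _).trans ?_
    rw [abs_mul, abs_mul]
    have h1 := mul_le_mul (hf.2.1 Y x) (hg.2.2 Y Z x) (abs_nonneg _)
      ((abs_nonneg _).trans (hf.2.1 Y x))
    have h2 := mul_le_mul (hf.2.2 Y Z x) (hg.2.1 Z x) (abs_nonneg _)
      ((abs_nonneg _).trans (hf.2.2 Y Z x))
    linarith

theorem BL.sub {M L M' L' : ℝ} {f g : ℝ × ℝ → Spc → ℝ} (hf : BL M L f) (hg : BL M' L' g) :
    BL (M + M') (L + L') (fun Y x => f Y x - g Y x) := by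
  refine ⟨fun Y => (hf.1 Y).sub (hg.1 Y), fun Y x => ?_, fun Y Z x => ?_⟩
  · exact (abs_sub _ _).trans (add_le_add (hf.2.1 Y x) (hg.2.1 Y x))
  · have : f Y x - g Y x - (f Z x - g Z x) = (f Y x - f Z x) - (g Y x - g Z x) := by ring
    rw [this]
    refine (abs_sub _ _).trans ?_
    linarith [hf.2.2 Y Z x, hg.2.2 Y Z x]

theorem BL.const (c : ℝ) : BL |c| 0 (fun _ _ => c) :=
  ⟨fun _ => measurable_const, fun _ _ => le_refl _, fun Y Z x => by simp⟩

theorem BL.ofFun {M : ℝ} {f : Spc → ℝ} (hf : Measurable f) (hM : ∀ x, |f x| ≤ M) :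
    BL M 0 (fun _ x => f x) :=
  ⟨fun _ => hf, fun _ x => hM x, fun Y Z x => by simp⟩

theorem BL.J {M L : ℝ} {f : ℝ × ℝ → Spc → ℝ} (hf : BL M L f) (k k' : ℝ → ℝ)
    (hd : ∀ x, HasDerivAt k (k' x) x) (hc : Continuous k') (hi : Integrable k')
    (hk : Integrable k) (θ : ℝ × ℝ → ℝ) (hθ : ∀ Y Z, |θ Y - θ Z| ≤ ‖Y - Z‖) :
    (∀ Y, |∫ x in cell, f Y x * k (x 0 - θ Y)| ≤ M * ∫ x, |k x|) ∧
    ∀ Y Z, |(∫ x in cell, f Y x * k (x 0 - θ Y)) - ∫ x in cell, f Z x * k (x 0 - θ Z)|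
      ≤ (M * (∫ x, |k' x|) + L * ∫ x, |k x|) * ‖Y - Z‖ := by
  have hkc : Continuous k := continuous_iff_continuousAt.2 fun x => (hd x).continuousAt
  have hM : 0 ≤ M := (abs_nonneg _).trans (hf.2.1 0 0)
  -- transfer
  have tr : ∀ h : ℝ → ℝ, Integrable h →
      Integrable (fun x : Spc => h (x 0)) (volume.restrict cell) := by
    intro h hh
    exact map_cell.integrable_comp_of_integrable hh
  have trI : ∀ h : ℝ → ℝ, Integrable h →
      ∫ x in cell, |h (x 0)| = ∫ x, |h x| := by
    intro h hh
    have h1 : AEStronglyMeasurable (fun x => |h x|)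
      (Measure.map (fun x : Spc => x 0) (volume.restrict cell)) := by
      rw [map_cell.map_eq]; exact hh.abs.aestronglyMeasurable
    have := integral_map map_cell.measurable.aemeasurable h1
    rw [map_cell.map_eq] at this
    exact this.symm
  have gen : ∀ (φ : Spc → ℝ) (h : ℝ → ℝ) (m : ℝ), Measurable φ → (∀ x, |φ x| ≤ m) → Integrable h →
      Integrable (fun x : Spc => φ x * h (x 0)) (volume.restrict cell) ∧
      |∫ x in cell, φ x * h (x 0)| ≤ m * ∫ x, |h x| := by
    intro φ h m hφ hm hh
    refine ⟨(tr h hh).bdd_mul hφ.aestronglyMeasurable (Eventually.of_forall hm), ?_⟩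
    rw [← trI h hh, ← integral_const_mul]
    refine norm_integral_le_of_norm_le (f := fun x : Spc => φ x * h (x 0)) (((tr h hh).abs).const_mul m) ?_
    refine Eventually.of_forall ?_
    intro x
    rw [Real.norm_eq_abs, abs_mul]
    exact mul_le_mul_of_nonneg_right (hm x) (abs_nonneg _)
  have ki : ∀ a, Integrable (fun x => k (x - a)) := fun a => hk.comp_sub_right a
  have kI : ∀ a, ∫ x, |k (x - a)| = ∫ x, |k x| := fun a =>
    integral_sub_right_eq_self (fun x => |k x|) a
  refine ⟨fun Y => ?_, fun Y Z => ?_⟩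
  · have := (gen (f Y) (fun x => k (x - θ Y)) M (hf.1 Y) (hf.2.1 Y) (ki _)).2
    rwa [kI] at this
  · have i1 := (gen (f Y) (fun x => k (x - θ Y)) M (hf.1 Y) (hf.2.1 Y) (ki _)).1
    have i2 := (gen (f Z) (fun x => k (x - θ Z)) M (hf.1 Z) (hf.2.1 Z) (ki _)).1
    have ht := translate_L1 k k' hd hc hi (θ Y) (θ Z)
    have j1 := gen (f Y) (fun x => k (x - θ Y) - k (x - θ Z)) M (hf.1 Y) (hf.2.1 Y) ht.1
    have j2 := gen (fun x => f Y x - f Z x) (fun x => k (x - θ Z)) (L * ‖Y - Z‖)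
      ((hf.1 Y).sub (hf.1 Z)) (hf.2.2 Y Z) (ki _)
    rw [← integral_sub i1 i2]
    have heq : ∀ x : Spc, f Y x * k (x 0 - θ Y) - f Z x * k (x 0 - θ Z)
        = f Y x * (k (x 0 - θ Y) - k (x 0 - θ Z)) + (f Y x - f Z x) * k (x 0 - θ Z) := by
      intro x; ring
    simp_rw [heq]
    rw [integral_add j1.1 j2.1]
    refine (abs_add_le _ _).trans ?_
    have e1 := j1.2
    have e2 := j2.2
    rw [kI] at e2
    have hk' : 0 ≤ ∫ x, |k' x| := by positivity
    have e3 : M * ∫ x, |k (x - θ Y) - k (x - θ Z)| ≤ M * ((∫ x, |k' x|) * ‖Y - Z‖) := by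
      refine mul_le_mul_of_nonneg_left (ht.2.trans ?_) hM
      exact mul_le_mul_of_nonneg_left (hθ Y Z) hk'
    linarith

/-! ### Facts about viscous shock profiles -/

theorem deriv_lim_zero {f : ℝ → ℝ} {a l : ℝ} (hf : Differentiable ℝ f)
    (hlim : Tendsto f atTop (𝓝 a)) (hd : Tendsto (deriv f) atTop (𝓝 l)) : l = 0 := by
  have hex : ∀ x : ℝ, ∃ c ∈ Ioo x (x + 1), deriv f c = f (x + 1) - f x := by
    intro x
    obtain ⟨c, hc, h⟩ := exists_deriv_eq_slope f (by linarith : x < x + 1)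
      hf.continuous.continuousOn hf.differentiableOn
    exact ⟨c, hc, by simpa using h⟩
  choose c hc hcd using hex
  have hct : Tendsto c atTop atTop := tendsto_atTop_mono (fun x => (hc x).1.le) tendsto_id
  have h1 : Tendsto (fun x => f (x + 1) - f x) atTop (𝓝 (a - a)) :=
    (hlim.comp (tendsto_atTop_add_const_right _ 1 tendsto_id)).sub hlim
  have h2 : Tendsto (fun x => f (x + 1) - f x) atTop (𝓝 l) := by
    simp_rw [← hcd]
    exact hd.comp hct
  simpa using tendsto_nhds_unique h2 h1

theorem hasDerivAt_pfn (γ : ℝ) {x : ℝ} (hx : 0 < x) :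
    HasDerivAt (pfn γ) (-γ * x ^ (-γ - 1)) x :=
  Real.hasDerivAt_rpow_const (Or.inl hx.ne')

theorem strictConvex_g (γ s : ℝ) (hγ : 1 < γ) :
    StrictConvexOn ℝ (Ioi 0) (fun x => s * x + pfn γ x) := by
  have hd : ∀ x ∈ Ioi (0:ℝ), HasDerivAt (fun x => s * x + pfn γ x)
      (s + -γ * x ^ (-γ - 1)) x := by
    intro x hx
    have := ((hasDerivAt_id x).const_mul s).add (hasDerivAt_pfn γ hx)
    refine this.congr_deriv (by simp)
  refine StrictMonoOn.strictConvexOn_of_deriv (convex_Ioi 0) ?_ ?_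
  · intro x hx
    exact (hd x hx).continuousAt.continuousWithinAt
  · rw [interior_Ioi]
    intro x hx y hy hxy
    rw [(hd x hx).deriv, (hd y hy).deriv]
    have := Real.rpow_lt_rpow_of_neg hx hxy (by linarith : -γ - 1 < 0)
    nlinarith

theorem sign_g {g : ℝ → ℝ} (hg : StrictConvexOn ℝ (Ioi 0) g) {a b K : ℝ} (ha : 0 < a)
    (hab : a < b) (hga : g a = K) (hgb : g b = K) :
    (∀ x, 0 < x → x < a → K < g x) ∧ (∀ x, b < x → K < g x) ∧ ∀ x ∈ Icc a b, g x ≤ K := by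
  have hb : 0 < b := ha.trans hab
  refine ⟨fun x hx hxa => ?_, fun x hx => ?_, fun x hx => ?_⟩
  · by_contra hcon
    push Not at hcon
    have h := hg.lt_on_openSegment (x := x) (y := b) (z := a) hx hb (by linarith) (by
      rw [openSegment_eq_Ioo (by linarith)]; exact ⟨hxa, hab⟩)
    rw [hga, hgb, max_eq_right hcon] at h
    exact lt_irrefl _ h
  · by_contra hcon
    push Not at hcon
    have h := hg.lt_on_openSegment (x := a) (y := x) (z := b) ha (hb.trans hx) (by linarith) (by
      rw [openSegment_eq_Ioo (by linarith)]; exact ⟨hab, hx⟩)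
    rw [hga, hgb, max_eq_left hcon] at h
    exact lt_irrefl _ h
  · have h := hg.convexOn.le_on_segment (x := a) (y := b) (z := x) ha hb (by
      rw [segment_eq_Icc hab.le]; exact hx)
    rwa [hga, hgb, max_self] at h

/-- A continuous function whose limits at both ends are `≥ m` and which has a value `< m`
attains its minimum. -/
theorem exists_min_aux {f : ℝ → ℝ} (hf : Continuous f) {m l r : ℝ}
    (hl : Tendsto f atBot (𝓝 l)) (hr : Tendsto f atTop (𝓝 r)) (hml : m ≤ l) (hmr : m ≤ r)
    {x₀ : ℝ} (hx₀ : f x₀ < m) : ∃ x, f x < m ∧ ∀ y, f x ≤ f y := by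
  obtain ⟨x, hx⟩ := hf.exists_forall_le' x₀ (by
    rw [cocompact_eq_atBot_atTop, eventually_sup]
    exact ⟨(hl.eventually (lt_mem_nhds (hx₀.trans_le hml))).mono fun y hy => hy.le,
      (hr.eventually (lt_mem_nhds (hx₀.trans_le hmr))).mono fun y hy => hy.le⟩)
  exact ⟨x, (hx x₀).trans_lt hx₀, hx⟩

theorem integrableOn_reflect {f : ℝ → ℝ} (h : IntegrableOn (fun x => f (-x)) (Ioi 0)) :
    IntegrableOn f (Iio 0) := by
  have h1 := (Measure.measurePreserving_neg (volume : Measure ℝ)).integrableOn_comp_preimage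
    (Homeomorph.neg ℝ).measurableEmbedding (f := f) (s := Iio 0)
  refine h1.1 ?_
  have : (Neg.neg ⁻¹' Iio (0:ℝ)) = Ioi 0 := by ext x; simp
  rw [this]
  exact h

theorem shock_facts {γ μ lam σ vL uL vR uR : ℝ} {vt ut : ℝ → ℝ} (hγ : 1 < γ)
    (hκ : 0 < 2 * μ + lam) (hσ : σ ≠ 0) (hvL : 0 < vL) (hvR : 0 < vR) (hne : vL ≠ vR)
    (hrh1 : -σ * (vR - vL) = uR - uL)
    (hrh2 : -σ * (uR - uL) + (pfn γ vR - pfn γ vL) = 0)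
    (h : ViscousShock γ μ lam σ vL uL vR uR vt ut) :
    (∀ ξ, min vL vR ≤ vt ξ ∧ vt ξ ≤ max vL vR) ∧
    (∃ D, 0 ≤ D ∧ ∀ a b, |vt a - vt b| ≤ D * |a - b|) ∧
    (∀ ξ, deriv (heff μ lam vt ut) ξ = deriv (fun y => pfn γ (vt y)) ξ / σ) ∧
    ∃ k' : ℝ → ℝ, (∀ x, HasDerivAt (deriv (fun y => pfn γ (vt y))) (k' x) x) ∧ Continuous k' ∧
      Integrable k' ∧ Integrable (deriv (fun y => pfn γ (vt y))) := by
  set κ := 2 * μ + lam with hκdef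
  have hκ0 : κ ≠ 0 := hκ.ne'
  have hv1 : Differentiable ℝ vt := h.smooth_v.differentiable (by norm_num)
  have hu1 : Differentiable ℝ ut := h.smooth_u.differentiable (by norm_num)
  have hvc : Continuous vt := hv1.continuous
  have hdv : ContDiff ℝ 2 (deriv vt) := by
    have h3 : ContDiff ℝ (2 + 1) vt := by
      have := h.smooth_v; norm_num; exact this
    exact (contDiff_succ_iff_deriv.1 h3).2.2
  have hv2 : Differentiable ℝ (deriv vt) := hdv.differentiable (by norm_num)
  have hdu : deriv ut = fun ξ => -σ * deriv vt ξ := by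
    funext ξ; exact (h.ode1 ξ).symm
  have hddu : ∀ ξ, deriv (deriv ut) ξ = -σ * deriv (deriv vt) ξ := by
    intro ξ
    rw [hdu]
    exact deriv_const_mul _ (hv2 ξ)
  have hp : ∀ ξ, HasDerivAt (fun y => pfn γ (vt y)) (-γ * vt ξ ^ (-γ - 1) * deriv vt ξ) ξ := by
    intro ξ
    exact (hasDerivAt_pfn γ (h.pos ξ)).comp ξ (hv1 ξ).hasDerivAt
  have hode : ∀ ξ, σ ^ 2 * deriv vt ξ + deriv (fun y => pfn γ (vt y)) ξ
      + κ * σ * deriv (deriv vt) ξ = 0 := by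
    intro ξ
    have h2 := h.ode2 ξ
    rw [hddu, hdu] at h2
    simp only at h2
    linarith
  -- first integral
  set g : ℝ → ℝ := fun x => σ ^ 2 * x + pfn γ x with hgdef
  have hW : ∀ ξ, HasDerivAt (fun y => g (vt y) + κ * σ * deriv vt y) 0 ξ := by
    intro ξ
    have h1 := (((hv1 ξ).hasDerivAt.const_mul (σ ^ 2)).add (hp ξ)).add
      ((hv2 ξ).hasDerivAt.const_mul (κ * σ))
    refine h1.congr_deriv ?_
    rw [← (hp ξ).deriv]
    exact hode ξ
  obtain ⟨K, hK⟩ : ∃ K, ∀ ξ, g (vt ξ) + κ * σ * deriv vt ξ = K :=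
    ⟨_, fun ξ => is_const_of_deriv_eq_zero (fun x => (hW x).differentiableAt)
      (fun x => (hW x).deriv) ξ 0⟩
  have hdvt : ∀ ξ, deriv vt ξ = (K - g (vt ξ)) / (κ * σ) := by
    intro ξ
    rw [eq_div_iff (mul_ne_zero hκ0 hσ)]
    linarith [hK ξ]
  have hgc : ∀ x, 0 < x → ContinuousAt g x := by
    intro x hx
    exact (continuousAt_const.mul continuousAt_id).add (hasDerivAt_pfn γ hx).continuousAt
  have hKR : g vR = K := by
    have h1 : Tendsto (deriv vt) atTop (𝓝 ((K - g vR) / (κ * σ))) := by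
      have : deriv vt = fun ξ => (K - g (vt ξ)) / (κ * σ) := funext hdvt
      rw [this]
      exact (tendsto_const_nhds.sub ((hgc vR hvR).tendsto.comp h.limR_v)).div_const _
    have h2 := deriv_lim_zero hv1 h.limR_v h1
    rw [div_eq_zero_iff] at h2
    rcases h2 with h2 | h2
    · linarith
    · exact absurd h2 (mul_ne_zero hκ0 hσ)
  have hKL : g vL = K := by
    rw [← hKR]
    simp only [hgdef]
    rw [← hrh1] at hrh2
    linarith
  have hsc := strictConvex_g γ (σ ^ 2) hγ
  set a := min vL vR with ha
  set b := max vL vR with hb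
  have ha0 : 0 < a := lt_min hvL hvR
  have hab : a < b := by
    rcases lt_or_gt_of_ne hne with h' | h'
    · rw [ha, hb, min_eq_left h'.le, max_eq_right h'.le]; exact h'
    · rw [ha, hb, min_eq_right h'.le, max_eq_left h'.le]; exact h'
  have hga : g a = K := by
    rcases min_choice vL vR with h' | h' <;> rw [ha, h'] <;> assumption
  have hgb : g b = K := by
    rcases max_choice vL vR with h' | h' <;> rw [hb, h'] <;> assumption
  obtain ⟨s1, s2, s3⟩ := sign_g hsc ha0 hab hga hgb
  have hlow : ∀ ξ, a ≤ vt ξ := by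
    intro ξ
    by_contra hcon
    push Not at hcon
    obtain ⟨x, hx, hmin⟩ := exists_min_aux hvc h.limL_v h.limR_v (min_le_left _ _)
      (min_le_right _ _) hcon
    have hloc : IsLocalMin vt x := Eventually.of_forall hmin
    have h0 := hK x
    rw [hloc.deriv_eq_zero] at h0
    have := s1 _ (h.pos x) hx
    linarith
  have hup : ∀ ξ, vt ξ ≤ b := by
    intro ξ
    by_contra hcon
    push Not at hcon
    obtain ⟨x, hx, hmin⟩ := exists_min_aux (f := fun y => -vt y) (m := -b) hvc.neg h.limL_v.neg
      h.limR_v.neg (neg_le_neg (le_max_left _ _)) (neg_le_neg (le_max_right _ _))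
      (x₀ := ξ) (neg_lt_neg hcon)
    have hloc : IsLocalMax vt x := Eventually.of_forall fun y => neg_le_neg_iff.1 (hmin y)
    have h0 := hK x
    rw [hloc.deriv_eq_zero] at h0
    have := s2 (vt x) (by linarith)
    linarith
  have hmem : ∀ ξ, vt ξ ∈ Icc a b := fun ξ => ⟨hlow ξ, hup ξ⟩
  have hvtInt : Integrable (deriv vt) := by
    have hsplit : IntegrableOn (deriv vt) (Iic 0) ∧ IntegrableOn (deriv vt) (Ioi 0) := by
      rcases lt_or_gt_of_ne hσ with hs | hs
      · have hneg : ∀ ξ, deriv vt ξ ≤ 0 := by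
          intro ξ
          rw [hdvt]
          exact div_nonpos_of_nonneg_of_nonpos (by linarith [s3 _ (hmem ξ)])
            (mul_nonpos_of_nonneg_of_nonpos hκ.le hs.le)
        refine ⟨?_, integrableOn_Ioi_deriv_of_nonpos' (fun x _ => (hv1 x).hasDerivAt)
          (fun x _ => hneg x) h.limR_v⟩
        have h1 : IntegrableOn (fun x => -deriv vt (-x)) (Ioi 0) := by
          refine integrableOn_Ioi_deriv_of_nonneg' (g := fun x => vt (-x)) (l := vL) ?_ ?_ ?_
          · intro x _
            have := (hv1 (-x)).hasDerivAt.comp x (hasDerivAt_neg x)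
            simpa [Function.comp_def] using this
          · intro x _
            linarith [hneg (-x)]
          · exact h.limL_v.comp tendsto_neg_atTop_atBot
        have h2 := h1.neg
        have h3 : IntegrableOn (fun x => deriv vt (-x)) (Ioi 0) := by
          simpa [Pi.neg_def] using h2
        rw [integrableOn_Iic_iff_integrableOn_Iio]
        exact integrableOn_reflect h3
      · have hneg : ∀ ξ, 0 ≤ deriv vt ξ := by
          intro ξ
          rw [hdvt]
          exact div_nonneg (by linarith [s3 _ (hmem ξ)]) (mul_nonneg hκ.le hs.le)
        refine ⟨?_, integrableOn_Ioi_deriv_of_nonneg' (fun x _ => (hv1 x).hasDerivAt)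
          (fun x _ => hneg x) h.limR_v⟩
        have h1 : IntegrableOn (fun x => -deriv vt (-x)) (Ioi 0) := by
          refine integrableOn_Ioi_deriv_of_nonpos' (g := fun x => vt (-x)) (l := vL) ?_ ?_ ?_
          · intro x _
            have := (hv1 (-x)).hasDerivAt.comp x (hasDerivAt_neg x)
            simpa [Function.comp_def] using this
          · intro x _
            linarith [hneg (-x)]
          · exact h.limL_v.comp tendsto_neg_atTop_atBot
        have h2 := h1.neg
        have h3 : IntegrableOn (fun x => deriv vt (-x)) (Ioi 0) := by
          simpa [Pi.neg_def] using h2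
        rw [integrableOn_Iic_iff_integrableOn_Iio]
        exact integrableOn_reflect h3
    rw [← integrableOn_univ, ← Iic_union_Ioi (a := (0:ℝ))]
    exact hsplit.1.union hsplit.2
  -- bounded continuous functions of `vt`
  have bddcomp : ∀ P : ℝ → ℝ, ContinuousOn P (Ioi 0) →
      Continuous (fun ξ => P (vt ξ)) ∧ ∃ C, ∀ ξ, |P (vt ξ)| ≤ C := by
    intro P hP
    refine ⟨hP.comp_continuous hvc h.pos, ?_⟩
    obtain ⟨C, hC⟩ := isCompact_Icc.exists_bound_of_continuousOn
      (hP.mono (fun x (hx : x ∈ Icc a b) => ha0.trans_le hx.1))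
    exact ⟨C, fun ξ => hC _ (hmem ξ)⟩
  have hrp : ∀ q : ℝ, ContinuousOn (fun x : ℝ => x ^ q) (Ioi 0) := fun q x hx =>
    (Real.continuousAt_rpow_const x q (Or.inl (ne_of_gt hx))).continuousWithinAt
  have hgcon : ContinuousOn g (Ioi 0) := fun x hx => (hgc x hx).continuousWithinAt
  have hkeq : deriv (fun y => pfn γ (vt y)) = fun ξ => -γ * vt ξ ^ (-γ - 1) * deriv vt ξ :=
    funext fun ξ => (hp ξ).deriv
  refine ⟨hmem, ?_, ?_, ?_⟩
  · obtain ⟨C, hC⟩ := (bddcomp (fun x => (K - g x) / (κ * σ))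
      ((continuousOn_const.sub hgcon).div_const _)).2
    refine ⟨C, (abs_nonneg _).trans (hC 0), fun x y => ?_⟩
    have := Convex.norm_image_sub_le_of_norm_deriv_le (f := vt) (C := C) (s := univ) (x := y)
      (y := x) (fun z _ => hv1 z) (fun z _ => by rw [hdvt]; exact hC z) convex_univ
      (mem_univ _) (mem_univ _)
    simpa using this
  · intro ξ
    have h1 : HasDerivAt (heff μ lam vt ut) (deriv ut ξ - κ * deriv (deriv vt) ξ) ξ :=
      (hu1 ξ).hasDerivAt.sub ((hv2 ξ).hasDerivAt.const_mul κ)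
    rw [h1.deriv, eq_div_iff hσ, hdu]
    simp only
    linarith [hode ξ]
  · refine ⟨fun ξ => (γ * (γ + 1) * vt ξ ^ (-γ - 2) * ((K - g (vt ξ)) / (κ * σ))
      + γ * vt ξ ^ (-γ - 1) * (σ ^ 2 + -γ * vt ξ ^ (-γ - 1)) / (κ * σ)) * deriv vt ξ, ?_, ?_, ?_, ?_⟩
    · intro ξ
      rw [hkeq]
      have h1 : HasDerivAt (fun y => vt y ^ (-γ - 1))
          ((-γ - 1) * vt ξ ^ (-γ - 1 - 1) * deriv vt ξ) ξ :=
        (Real.hasDerivAt_rpow_const (x := vt ξ) (p := -γ - 1)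
          (Or.inl (h.pos ξ).ne')).comp ξ (hv1 ξ).hasDerivAt
      have h2 := (h1.const_mul (-γ)).mul (hv2 ξ).hasDerivAt
      refine h2.congr_deriv ?_
      have h3 : deriv (deriv vt) ξ =
          -((σ ^ 2 + -γ * vt ξ ^ (-γ - 1)) * deriv vt ξ) / (κ * σ) := by
        rw [eq_div_iff (mul_ne_zero hκ0 hσ)]
        have := hode ξ
        rw [hkeq] at this
        simp only at this
        linarith
      simp only
      rw [h3, ← hdvt, show -γ - 1 - 1 = -γ - 2 by ring]
      ring
    · refine Continuous.mul ?_ hdv.continuous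
      refine (bddcomp (fun x => γ * (γ + 1) * x ^ (-γ - 2) * ((K - g x) / (κ * σ))
        + γ * x ^ (-γ - 1) * (σ ^ 2 + -γ * x ^ (-γ - 1)) / (κ * σ)) ?_).1
      have := hrp (-γ - 2)
      have := hrp (-γ - 1)
      fun_prop
    · obtain ⟨c1, C, hC⟩ := bddcomp (fun x => γ * (γ + 1) * x ^ (-γ - 2) * ((K - g x) / (κ * σ))
        + γ * x ^ (-γ - 1) * (σ ^ 2 + -γ * x ^ (-γ - 1)) / (κ * σ)) (by
          have := hrp (-γ - 2)
          have := hrp (-γ - 1)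
          fun_prop)
      exact hvtInt.bdd_mul c1.aestronglyMeasurable (Eventually.of_forall hC)
    · rw [hkeq]
      obtain ⟨c1, C, hC⟩ := bddcomp (fun x => -γ * x ^ (-γ - 1)) (by
          have := hrp (-γ - 1)
          fun_prop)
      exact hvtInt.bdd_mul c1.aestronglyMeasurable (Eventually.of_forall hC)

/-! ### Estimates on the right-hand sides of the shift ODE -/

theorem pfn_anti {γ m x : ℝ} (hγ : 1 < γ) (hm : 0 < m) (hx : m ≤ x) :
    |pfn γ x| ≤ pfn γ m := by
  have h0 : 0 ≤ pfn γ x := Real.rpow_nonneg (hm.le.trans hx) _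
  rw [abs_of_nonneg h0]
  exact Real.rpow_le_rpow_of_nonpos hm hx (by linarith)

theorem pfn_lip {γ m x y : ℝ} (hγ : 1 < γ) (hm : 0 < m) (hx : m ≤ x) (hy : m ≤ y) :
    |pfn γ x - pfn γ y| ≤ γ * m ^ (-γ - 1) * |x - y| := by
  have := Convex.norm_image_sub_le_of_norm_hasDerivWithin_le (f := pfn γ) (s := Ici m)
    (f' := fun z => -γ * z ^ (-γ - 1)) (C := γ * m ^ (-γ - 1)) (x := y) (y := x)
    (fun z hz => (hasDerivAt_pfn γ (hm.trans_le hz)).hasDerivWithinAt) (fun z hz => by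
      have hz' : m ≤ z := hz
      have h0 : 0 ≤ z ^ (-γ - 1) := Real.rpow_nonneg (hm.le.trans hz') _
      rw [Real.norm_eq_abs, abs_mul, abs_neg, abs_of_pos (by linarith : 0 < γ), abs_of_nonneg h0]
      exact mul_le_mul_of_nonneg_left (Real.rpow_le_rpow_of_nonpos hm hz' (by linarith))
        (by linarith)) (convex_Ici m) hy hx
  simpa using this

theorem measurable_pfn (γ : ℝ) : Measurable (pfn γ) := by
  unfold pfn
  fun_prop

/-- Uniformly bounded and Lipschitz families. -/
def UBL {ι : Type} (f : ι → ℝ × ℝ → Spc → ℝ) : Prop := ∃ M L, ∀ i, BL M L (f i)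

theorem UBL.mul {ι : Type} {f g : ι → ℝ × ℝ → Spc → ℝ} (hf : UBL f) (hg : UBL g) :
    UBL (fun i Y x => f i Y x * g i Y x) := by
  obtain ⟨M, L, h⟩ := hf
  obtain ⟨M', L', h'⟩ := hg
  exact ⟨_, _, fun i => (h i).mul (h' i)⟩

theorem UBL.sub {ι : Type} {f g : ι → ℝ × ℝ → Spc → ℝ} (hf : UBL f) (hg : UBL g) :
    UBL (fun i Y x => f i Y x - g i Y x) := by
  obtain ⟨M, L, h⟩ := hf
  obtain ⟨M', L', h'⟩ := hg
  exact ⟨_, _, fun i => (h i).sub (h' i)⟩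

theorem UBL.const {ι : Type} (c : ℝ) : UBL (fun (_ : ι) _ _ => c) :=
  ⟨_, _, fun _ => BL.const c⟩

theorem UBL.add {ι : Type} {f g : ι → ℝ × ℝ → Spc → ℝ} (hf : UBL f) (hg : UBL g) :
    UBL (fun i Y x => f i Y x + g i Y x) := by
  have := hf.sub ((UBL.const 0).sub hg)
  simpa using this

theorem UBL.div_const {ι : Type} {f : ι → ℝ × ℝ → Spc → ℝ} (hf : UBL f) (c : ℝ) :
    UBL (fun i Y x => f i Y x / c) := by
  simp_rw [div_eq_mul_inv]
  exact hf.mul (UBL.const _)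

theorem UBL.pfn {ι : Type} {f : ι → ℝ × ℝ → Spc → ℝ} (hf : UBL f) {γ m : ℝ} (hγ : 1 < γ)
    (hm : 0 < m) (hfm : ∀ i Y x, m ≤ f i Y x) : UBL (fun i Y x => pfn γ (f i Y x)) := by
  obtain ⟨M, L, h⟩ := hf
  refine ⟨NS3D.pfn γ m, γ * m ^ (-γ - 1) * L, fun i => ⟨fun Y => ?_, fun Y x => ?_,
    fun Y Z x => ?_⟩⟩
  · exact (measurable_pfn γ).comp ((h i).1 Y)
  · exact pfn_anti hγ hm (hfm i Y x)
  · refine (pfn_lip hγ hm (hfm i Y x) (hfm i Z x)).trans ?_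
    rw [mul_assoc]
    have h0 : 0 ≤ γ * m ^ (-γ - 1) := mul_nonneg (by linarith) (Real.rpow_nonneg hm.le _)
    rw [← mul_assoc, mul_assoc _ L]
    exact mul_le_mul_of_nonneg_left ((h i).2.2 Y Z x) h0

theorem UBL.prof {ι : Type} {f : ℝ → ℝ} {M D : ℝ} (hf : Measurable f) (hM : ∀ x, |f x| ≤ M)
    (hD0 : 0 ≤ D) (hD : ∀ a b, |f a - f b| ≤ D * |a - b|) (s : ι → ℝ) (pr : ℝ × ℝ → ℝ)
    (hpr : ∀ Y Z, |pr Y - pr Z| ≤ ‖Y - Z‖) : UBL (fun i Y x => f (x 0 - s i - pr Y)) := by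
  refine ⟨M, D, fun i => ⟨fun Y => ?_, fun Y x => hM _, fun Y Z x => ?_⟩⟩
  · exact hf.comp (by fun_prop)
  · refine (hD _ _).trans (mul_le_mul_of_nonneg_left ?_ hD0)
    refine le_trans (le_of_eq ?_) (hpr Y Z)
    rw [show x 0 - s i - pr Y - (x 0 - s i - pr Z) = -(pr Y - pr Z) by ring, abs_neg]

theorem UBL.J {ι : Type} {f : ι → ℝ × ℝ → Spc → ℝ} (hf : UBL f) (k k' : ℝ → ℝ)
    (hd : ∀ x, HasDerivAt k (k' x) x) (hc : Continuous k') (hi : Integrable k')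
    (hk : Integrable k) (s : ι → ℝ) (pr : ℝ × ℝ → ℝ) (hpr : ∀ Y Z, |pr Y - pr Z| ≤ ‖Y - Z‖) :
    ∃ B L, ∀ i, (∀ Y, |∫ x in cell, f i Y x * k (x 0 - s i - pr Y)| ≤ B) ∧
    ∀ Y Z, |(∫ x in cell, f i Y x * k (x 0 - s i - pr Y))
      - ∫ x in cell, f i Z x * k (x 0 - s i - pr Z)| ≤ L * ‖Y - Z‖ := by
  obtain ⟨M, L, h⟩ := hf
  refine ⟨M * ∫ x, |k x|, M * (∫ x, |k' x|) + L * ∫ x, |k x|, fun i => ?_⟩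
  have := (h i).J k k' hd hc hi hk (fun Y => s i + pr Y) (fun Y Z => by simpa using hpr Y Z)
  simp only [← sub_sub] at this
  exact this

theorem shift_bound {γ vm σ1 σ2 δ1 δ2 ν1 ν2 c1 c2 : ℝ} {vt1 vt2 : ℝ → ℝ} (hγ : 1 < γ)
    (hvm : 0 < vm) (hc1 : 0 < c1)
    (hm1 : Measurable vt1) (hm2 : Measurable vt2) {b1 b2 D1 D2 : ℝ}
    (hl1 : ∀ ξ, vm ≤ vt1 ξ) (hu1 : ∀ ξ, vt1 ξ ≤ b1)
    (hl2 : ∀ ξ, vm ≤ vt2 ξ) (hu2 : ∀ ξ, vt2 ξ ≤ b2)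
    (hD1 : 0 ≤ D1) (hL1 : ∀ a b, |vt1 a - vt1 b| ≤ D1 * |a - b|)
    (hD2 : 0 ≤ D2) (hL2 : ∀ a b, |vt2 a - vt2 b| ≤ D2 * |a - b|)
    (σ σs A : ℝ) (hh k k' : ℝ → ℝ) (hhk : ∀ ξ, hh ξ = k ξ / σs)
    (hd : ∀ x, HasDerivAt k (k' x) x) (hc : Continuous k') (hi : Integrable k')
    (hk : Integrable k) (pr : ℝ × ℝ → ℝ) (hpr : ∀ Y Z, |pr Y - pr Z| ≤ ‖Y - Z‖) :
    ∃ B L, 0 ≤ B ∧ 0 ≤ L ∧ ∀ (t : ℝ) (w : Spc → ℝ), Measurable w →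
      (∀ x, c1 ≤ w x ∧ w x ≤ c2) → ∀ H : ℝ × ℝ → ℝ,
      (∀ Y : ℝ × ℝ, H Y = A *
        ((∫ x in cell, (acompY γ vm σ1 σ2 δ1 δ2 ν1 ν2 vt1 vt2 t Y.1 Y.2 (x 0) / σs)
            * hh (x 0 - σ * t - pr Y)
            * (pfn γ (w x) - pfn γ (vcompY vm σ1 σ2 vt1 vt2 t Y.1 Y.2 (x 0))))
        - ∫ x in cell, acompY γ vm σ1 σ2 δ1 δ2 ν1 ν2 vt1 vt2 t Y.1 Y.2 (x 0)
            * k (x 0 - σ * t - pr Y)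
            * (w x - vcompY vm σ1 σ2 vt1 vt2 t Y.1 Y.2 (x 0)))) →
      (∀ Y, |H Y| ≤ B) ∧ ∀ Y Z, |H Y - H Z| ≤ L * ‖Y - Z‖ := by
  let ι : Type := {p : ℝ × (Spc → ℝ) // Measurable p.2 ∧ ∀ x, c1 ≤ p.2 x ∧ p.2 x ≤ c2}
  have hfst : ∀ Y Z : ℝ × ℝ, |Y.1 - Z.1| ≤ ‖Y - Z‖ := fun Y Z => norm_fst_le (Y - Z)
  have hsnd : ∀ Y Z : ℝ × ℝ, |Y.2 - Z.2| ≤ ‖Y - Z‖ := fun Y Z => norm_snd_le (Y - Z)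
  have hV1 : UBL (fun (i : ι) Y x => vt1 (x 0 - σ1 * i.1.1 - Y.1)) :=
    UBL.prof hm1 (M := b1) (fun x => by
      rw [abs_of_pos (hvm.trans_le (hl1 x))]; exact hu1 x) hD1 hL1 (fun i : ι => σ1 * i.1.1)
      Prod.fst hfst
  have hV2 : UBL (fun (i : ι) Y x => vt2 (x 0 - σ2 * i.1.1 - Y.2)) :=
    UBL.prof hm2 (M := b2) (fun x => by
      rw [abs_of_pos (hvm.trans_le (hl2 x))]; exact hu2 x) hD2 hL2 (fun i : ι => σ2 * i.1.1)
      Prod.snd hsnd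
  have hVC : UBL (fun (i : ι) Y x => vcompY vm σ1 σ2 vt1 vt2 i.1.1 Y.1 Y.2 (x 0)) :=
    (hV1.add hV2).sub (UBL.const vm)
  have hPVC := hVC.pfn hγ hvm (fun i Y x => by
    unfold vcompY
    linarith [hl1 (x 0 - σ1 * i.1.1 - Y.1), hl2 (x 0 - σ2 * i.1.1 - Y.2)])
  have hP1 := hV1.pfn hγ hvm (fun i Y x => hl1 _)
  have hP2 := hV2.pfn hγ hvm (fun i Y x => hl2 _)
  have hW1 : UBL (fun (i : ι) Y x => wgt γ δ1 ν1 vm vt1 (x 0 - σ1 * i.1.1 - Y.1)) :=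
    (UBL.const 1).add (((UBL.const ν1).mul ((UBL.const (NS3D.pfn γ vm)).sub hP1)).div_const δ1)
  have hW2 : UBL (fun (i : ι) Y x => wgt γ δ2 ν2 vm vt2 (x 0 - σ2 * i.1.1 - Y.2)) :=
    (UBL.const 1).add (((UBL.const ν2).mul ((UBL.const (NS3D.pfn γ vm)).sub hP2)).div_const δ2)
  have hA : UBL (fun (i : ι) Y x => acompY γ vm σ1 σ2 δ1 δ2 ν1 ν2 vt1 vt2 i.1.1 Y.1 Y.2 (x 0)) :=
    (hW1.add hW2).sub (UBL.const 1)
  have hw : UBL (fun (i : ι) (_ : ℝ × ℝ) x => i.1.2 x) :=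
    ⟨c2, 0, fun i => BL.ofFun i.2.1 fun x => by
      rw [abs_of_pos (hc1.trans_le (i.2.2 x).1)]; exact (i.2.2 x).2⟩
  have hPw := hw.pfn hγ hc1 (fun i Y x => (i.2.2 x).1)
  have hJ1 := (((hA.div_const σs).div_const σs).mul (hPw.sub hPVC)).J k k' hd hc hi hk
    (fun i : ι => σ * i.1.1) pr hpr
  have hJ2 := (hA.mul (hw.sub hVC)).J k k' hd hc hi hk (fun i : ι => σ * i.1.1) pr hpr
  obtain ⟨B1, L1, h1⟩ := hJ1
  obtain ⟨B2, L2, h2⟩ := hJ2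
  refine ⟨|A| * (|B1| + |B2|), |A| * (|L1| + |L2|), by positivity, by positivity, ?_⟩
  intro t w hwm hwb H hH
  have q1 := h1 ⟨(t, w), hwm, hwb⟩
  have q2 := h2 ⟨(t, w), hwm, hwb⟩
  simp only at q1 q2
  set I1 : ℝ × ℝ → ℝ := fun Y => ∫ x in cell,
    acompY γ vm σ1 σ2 δ1 δ2 ν1 ν2 vt1 vt2 t Y.1 Y.2 (x 0) / σs / σs
      * (pfn γ (w x) - pfn γ (vcompY vm σ1 σ2 vt1 vt2 t Y.1 Y.2 (x 0)))
      * k (x 0 - σ * t - pr Y) with hI1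
  set I2 : ℝ × ℝ → ℝ := fun Y => ∫ x in cell,
    acompY γ vm σ1 σ2 δ1 δ2 ν1 ν2 vt1 vt2 t Y.1 Y.2 (x 0)
      * (w x - vcompY vm σ1 σ2 vt1 vt2 t Y.1 Y.2 (x 0))
      * k (x 0 - σ * t - pr Y) with hI2
  have hHI : ∀ Y, H Y = A * (I1 Y - I2 Y) := by
    intro Y
    rw [hH Y]
    congr 2
    · refine integral_congr_ae (Eventually.of_forall fun x => ?_)
      simp only [hhk]
      ring
    · refine integral_congr_ae (Eventually.of_forall fun x => ?_)
      simp only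
      ring
  refine ⟨fun Y => ?_, fun Y Z => ?_⟩
  · rw [hHI, abs_mul]
    refine mul_le_mul_of_nonneg_left ?_ (abs_nonneg _)
    refine (abs_sub _ _).trans (add_le_add ?_ ?_)
    · exact (q1.1 Y).trans (le_abs_self _)
    · exact (q2.1 Y).trans (le_abs_self _)
  · rw [hHI, hHI, ← mul_sub, abs_mul, mul_assoc]
    refine mul_le_mul_of_nonneg_left ?_ (abs_nonneg _)
    rw [show I1 Y - I2 Y - (I1 Z - I2 Z) = (I1 Y - I1 Z) - (I2 Y - I2 Z) by ring, add_mul]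
    refine (abs_sub _ _).trans (add_le_add ?_ ?_)
    · exact (q1.2 Y Z).trans (mul_le_mul_of_nonneg_right (le_abs_self _) (norm_nonneg _))
    · exact (q2.2 Y Z).trans (mul_le_mul_of_nonneg_right (le_abs_self _) (norm_nonneg _))

theorem shift_meas {γ vm σ1 σ2 δ1 δ2 ν1 ν2 : ℝ} {vt1 vt2 : ℝ → ℝ}
    (hm1 : Measurable vt1) (hm2 : Measurable vt2) (σ σs A : ℝ) (hh k : ℝ → ℝ)
    (hhm : Measurable hh) (hkm : Measurable k) (v : ℝ → Spc → ℝ)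
    (hv : Measurable (Function.uncurry v)) (X1 X2 X : ℝ → ℝ) (hX1 : Measurable X1)
    (hX2 : Measurable X2) (hX : Measurable X) :
    StronglyMeasurable (fun t => A *
        ((∫ x in cell, (acompY γ vm σ1 σ2 δ1 δ2 ν1 ν2 vt1 vt2 t (X1 t) (X2 t) (x 0) / σs)
            * hh (x 0 - σ * t - X t)
            * (pfn γ (v t x) - pfn γ (vcompY vm σ1 σ2 vt1 vt2 t (X1 t) (X2 t) (x 0))))
        - ∫ x in cell, acompY γ vm σ1 σ2 δ1 δ2 ν1 ν2 vt1 vt2 t (X1 t) (X2 t) (x 0)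
            * k (x 0 - σ * t - X t)
            * (v t x - vcompY vm σ1 σ2 vt1 vt2 t (X1 t) (X2 t) (x 0)))) := by
  have hp := measurable_pfn γ
  have hv' : Measurable fun q : ℝ × Spc => v q.1 q.2 := hv
  have hx0 : Measurable fun q : ℝ × Spc => q.2 0 := by fun_prop
  have a1 : Measurable fun q : ℝ × Spc => vt1 (q.2 0 - σ1 * q.1 - X1 q.1) :=
    hm1.comp ((hx0.sub (measurable_fst.const_mul _)).sub (hX1.comp measurable_fst))
  have a2 : Measurable fun q : ℝ × Spc => vt2 (q.2 0 - σ2 * q.1 - X2 q.1) :=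
    hm2.comp ((hx0.sub (measurable_fst.const_mul _)).sub (hX2.comp measurable_fst))
  have a3 : Measurable fun q : ℝ × Spc => hh (q.2 0 - σ * q.1 - X q.1) :=
    hhm.comp ((hx0.sub (measurable_fst.const_mul _)).sub (hX.comp measurable_fst))
  have a4 : Measurable fun q : ℝ × Spc => k (q.2 0 - σ * q.1 - X q.1) :=
    hkm.comp ((hx0.sub (measurable_fst.const_mul _)).sub (hX.comp measurable_fst))
  have b1 : Measurable fun q : ℝ × Spc =>
      vcompY vm σ1 σ2 vt1 vt2 q.1 (X1 q.1) (X2 q.1) (q.2 0) :=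
    (a1.add a2).sub_const vm
  have b2 : Measurable fun q : ℝ × Spc =>
      acompY γ vm σ1 σ2 δ1 δ2 ν1 ν2 vt1 vt2 q.1 (X1 q.1) (X2 q.1) (q.2 0) :=
    ((((((hp.comp a1).const_sub _).const_mul ν1).div_const δ1).const_add 1).add
      (((((hp.comp a2).const_sub _).const_mul ν2).div_const δ2).const_add 1)).sub_const 1
  refine (StronglyMeasurable.sub ?_ ?_).const_mul A
  · exact StronglyMeasurable.integral_prod_right'
      (f := fun q : ℝ × Spc =>
        (acompY γ vm σ1 σ2 δ1 δ2 ν1 ν2 vt1 vt2 q.1 (X1 q.1) (X2 q.1) (q.2 0) / σs)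
            * hh (q.2 0 - σ * q.1 - X q.1)
            * (pfn γ (v q.1 q.2) - pfn γ (vcompY vm σ1 σ2 vt1 vt2 q.1 (X1 q.1) (X2 q.1) (q.2 0))))
      (((b2.div_const σs).mul a3).mul ((hp.comp hv').sub (hp.comp b1))).stronglyMeasurable
  · exact StronglyMeasurable.integral_prod_right'
      (f := fun q : ℝ × Spc =>
        acompY γ vm σ1 σ2 δ1 δ2 ν1 ν2 vt1 vt2 q.1 (X1 q.1) (X2 q.1) (q.2 0)
            * k (q.2 0 - σ * q.1 - X q.1)
            * (v q.1 q.2 - vcompY vm σ1 σ2 vt1 vt2 q.1 (X1 q.1) (X2 q.1) (q.2 0)))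
      ((b2.mul a4).mul (hv'.sub b1)).stronglyMeasurable

/-- Lemma 3.2: for any `0 < c₁ ≤ v ≤ c₂`, the shift ODE system has a
unique Lipschitz continuous solution on `[0, T]`, which moreover grows at most linearly. -/
theorem shift_ODE_wellposed
    (γ μ lam : ℝ) (hγ : 1 < γ) (hμ : 0 < μ) (hlam : 0 ≤ 2*μ + 3*lam)
    (vminus uminus vm um vplus uplus σ1s σ2s σ1 σ2 δ1 δ2 ν1 ν2 : ℝ)
    (vt1 ut1 vt2 ut2 : ℝ → ℝ)
    (hrh : RHLax γ σ1s σ2s vminus uminus vm um vplus uplus)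
    (hδ1 : δ1 = |pfn γ vminus - pfn γ vm|) (hδ1pos : 0 < δ1)
    (hδ2 : δ2 = |pfn γ vm - pfn γ vplus|) (hδ2pos : 0 < δ2)
    (hsh1 : ViscousShock γ μ lam σ1s vminus uminus vm um vt1 ut1)
    (hsh2 : ViscousShock γ μ lam σ2s vm um vplus uplus vt2 ut2)
    (hσ1 : σ1s * vminus = σ1 - uminus) (hσ2 : σ2s * vm = σ2 - um) (hσ : σ1 < σ2)
    (hν1 : δ1 < ν1) (hν1' : ν1 ≤ Real.sqrt δ1)
    (hν2 : δ2 < ν2) (hν2' : ν2 ≤ Real.sqrt δ2) :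
    ∀ c1 c2 : ℝ, 0 < c1 → 0 < c2 →
      ∃ C > 0, ∀ T > 0, ∀ v : ℝ → Spc → ℝ,
        Measurable (Function.uncurry v) →
        (∀ t ∈ Icc (0:ℝ) T, ∀ x : Spc, c1 ≤ v t x ∧ v t x ≤ c2) →
        ∃ X1 X2 : ℝ → ℝ,
          IsShiftSolOn γ μ lam vm σ1 σ2 σ1s σ2s δ1 δ2 ν1 ν2 (Mconst γ vm) T
            vt1 ut1 vt2 ut2 v X1 X2 ∧
          (∀ Y1 Y2 : ℝ → ℝ,
            IsShiftSolOn γ μ lam vm σ1 σ2 σ1s σ2s δ1 δ2 ν1 ν2 (Mconst γ vm) T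
              vt1 ut1 vt2 ut2 v Y1 Y2 →
            ∀ t ∈ Icc (0:ℝ) T, Y1 t = X1 t ∧ Y2 t = X2 t) ∧
          ∀ t ∈ Icc (0:ℝ) T, |X1 t| + |X2 t| ≤ C * t := by
  intro c1 c2 hc1 hc2
  have hκ : 0 < 2 * μ + lam := by linarith
  have hvm : 0 < vm := hrh.posm
  have hs1 : σ1s ≠ 0 := by
    intro h0
    have h1 := hrh.rh1v
    have h2 := hrh.lax1u
    rw [h0] at h1
    linarith
  have hs2 : σ2s ≠ 0 := by
    intro h0
    have h1 := hrh.rh2v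
    have h2 := hrh.lax2u
    rw [h0] at h1
    linarith
  obtain ⟨f1, ⟨D1, hD1, hL1⟩, hh1, k1, hk1, hk1c, hk1i, hki1⟩ := shock_facts hγ hκ hs1
    hrh.posminus hrh.posm hrh.lax1v.ne' hrh.rh1v hrh.rh1u hsh1
  obtain ⟨f2, ⟨D2, hD2, hL2⟩, hh2, k2, hk2, hk2c, hk2i, hki2⟩ := shock_facts hγ hκ hs2
    hrh.posm hrh.posplus hrh.lax2v.ne hrh.rh2v hrh.rh2u hsh2
  rw [min_eq_right hrh.lax1v.le] at f1
  rw [min_eq_left hrh.lax2v.le] at f2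
  have hm1 : Measurable vt1 := hsh1.smooth_v.continuous.measurable
  have hm2 : Measurable vt2 := hsh2.smooth_v.continuous.measurable
  have hfst : ∀ Y Z : ℝ × ℝ, |Y.1 - Z.1| ≤ ‖Y - Z‖ := fun Y Z => norm_fst_le (Y - Z)
  have hsnd : ∀ Y Z : ℝ × ℝ, |Y.2 - Z.2| ≤ ‖Y - Z‖ := fun Y Z => norm_snd_le (Y - Z)
  obtain ⟨B1, L1, hB1, hLp1, H1⟩ := shift_bound (σ1 := σ1) (σ2 := σ2) (δ1 := δ1) (δ2 := δ2)
    (ν1 := ν1) (ν2 := ν2) (c2 := c2) hγ hvm hc1 hm1 hm2 (fun ξ => (f1 ξ).1)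
    (fun ξ => (f1 ξ).2) (fun ξ => (f2 ξ).1) (fun ξ => (f2 ξ).2) hD1 hL1 hD2 hL2 σ1 σ1s
    (-(Mconst γ vm / δ1)) _ _ k1 hh1 hk1 hk1c hk1i hki1 Prod.fst hfst
  obtain ⟨B2, L2, hB2, hLp2, H2⟩ := shift_bound (σ1 := σ1) (σ2 := σ2) (δ1 := δ1) (δ2 := δ2)
    (ν1 := ν1) (ν2 := ν2) (c2 := c2) hγ hvm hc1 hm1 hm2 (fun ξ => (f1 ξ).1)
    (fun ξ => (f1 ξ).2) (fun ξ => (f2 ξ).1) (fun ξ => (f2 ξ).2) hD1 hL1 hD2 hL2 σ2 σ2s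
    (-(Mconst γ vm / δ2)) _ _ k2 hh2 hk2 hk2c hk2i hki2 Prod.snd hsnd
  refine ⟨B1 + B2 + 1, by positivity, ?_⟩
  intro T hT v hv hvb
  set S1 : ℝ → ℝ → ℝ → ℝ :=
    shiftF1 γ μ lam vm σ1 σ2 σ1s δ1 δ2 ν1 ν2 (Mconst γ vm) vt1 ut1 vt2 v with hS1
  set S2 : ℝ → ℝ → ℝ → ℝ :=
    shiftF2 γ μ lam vm σ1 σ2 σ2s δ1 δ2 ν1 ν2 (Mconst γ vm) vt1 vt2 ut2 v with hS2
  have E1 : ∀ t ∈ Icc 0 T, (∀ Y : ℝ × ℝ, |S1 t Y.1 Y.2| ≤ B1) ∧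
      ∀ Y Z : ℝ × ℝ, |S1 t Y.1 Y.2 - S1 t Z.1 Z.2| ≤ L1 * ‖Y - Z‖ := fun t ht =>
    H1 t (v t) (hv.comp (measurable_const.prodMk measurable_id)) (hvb t ht)
      (fun Y => S1 t Y.1 Y.2) (fun Y => rfl)
  have E2 : ∀ t ∈ Icc 0 T, (∀ Y : ℝ × ℝ, |S2 t Y.1 Y.2| ≤ B2) ∧
      ∀ Y Z : ℝ × ℝ, |S2 t Y.1 Y.2 - S2 t Z.1 Z.2| ≤ L2 * ‖Y - Z‖ := fun t ht =>
    H2 t (v t) (hv.comp (measurable_const.prodMk measurable_id)) (hvb t ht)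
      (fun Y => S2 t Y.1 Y.2) (fun Y => rfl)
  let G : ℝ → ℝ × ℝ → ℝ × ℝ := fun t Y => (S1 t Y.1 Y.2, S2 t Y.1 Y.2)
  have hGB : ∀ t ∈ Icc 0 T, ∀ y, ‖G t y‖ ≤ max B1 B2 := by
    intro t ht y
    exact max_le_max ((E1 t ht).1 y) ((E2 t ht).1 y)
  have hGL : ∀ t ∈ Icc 0 T, ∀ y z, ‖G t y - G t z‖ ≤ max L1 L2 * ‖y - z‖ := by
    intro t ht y z
    refine max_le ?_ ?_
    · exact ((E1 t ht).2 y z).trans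
        (mul_le_mul_of_nonneg_right (le_max_left _ _) (norm_nonneg _))
    · exact ((E2 t ht).2 y z).trans
        (mul_le_mul_of_nonneg_right (le_max_right _ _) (norm_nonneg _))
  have hGm : ∀ X : ℝ → ℝ × ℝ, Continuous X → StronglyMeasurable (fun s => G s (X s)) := by
    intro X hX
    have x1 : Measurable fun s => (X s).1 := hX.fst.measurable
    have x2 : Measurable fun s => (X s).2 := hX.snd.measurable
    refine StronglyMeasurable.prodMk ?_ ?_
    · exact shift_meas hm1 hm2 σ1 σ1s (-(Mconst γ vm / δ1)) _ _ (measurable_deriv _)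
        (measurable_deriv _) v hv _ _ _ x1 x2 x1
    · exact shift_meas hm1 hm2 σ2 σ2s (-(Mconst γ vm / δ2)) _ _ (measurable_deriv _)
        (measurable_deriv _) v hv _ _ _ x1 x2 x2
  obtain ⟨hint, X, hXc, hXeq, hXu⟩ := picard_aux G T (max B1 B2) (max L1 L2) hT
    (hLp1.trans (le_max_left _ _)) hGB hGL hGm
  have h0mem : (0:ℝ) ∈ Icc 0 T := ⟨le_refl _, hT.le⟩
  have i1 : ∀ Y : ℝ → ℝ × ℝ, ContinuousOn Y (Icc 0 T) → ∀ a ∈ Icc 0 T, ∀ b ∈ Icc 0 T,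
      IntervalIntegrable (fun s => S1 s (Y s).1 (Y s).2) volume a b := by
    intro Y hY a ha b hb
    exact ⟨(hint Y hY a ha b hb).1.fst, (hint Y hY a ha b hb).2.fst⟩
  have i2 : ∀ Y : ℝ → ℝ × ℝ, ContinuousOn Y (Icc 0 T) → ∀ a ∈ Icc 0 T, ∀ b ∈ Icc 0 T,
      IntervalIntegrable (fun s => S2 s (Y s).1 (Y s).2) volume a b := by
    intro Y hY a ha b hb
    exact ⟨(hint Y hY a ha b hb).1.snd, (hint Y hY a ha b hb).2.snd⟩
  have hpair : ∀ Y : ℝ → ℝ × ℝ, ContinuousOn Y (Icc 0 T) → ∀ t ∈ Icc 0 T,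
      ∫ s in (0:ℝ)..t, G s (Y s) = (∫ s in (0:ℝ)..t, S1 s (Y s).1 (Y s).2,
        ∫ s in (0:ℝ)..t, S2 s (Y s).1 (Y s).2) := by
    intro Y hY t ht
    rw [intervalIntegral.integral_of_le ht.1, intervalIntegral.integral_of_le ht.1,
      intervalIntegral.integral_of_le ht.1]
    exact integral_pair (i1 Y hY 0 h0mem t ht).1 (i2 Y hY 0 h0mem t ht).1
  have e1 : ∀ t ∈ Icc 0 T, (X t).1 = ∫ s in (0:ℝ)..t, S1 s (X s).1 (X s).2 := by
    intro t ht
    have h := hXeq t ht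
    rw [hpair X hXc.continuousOn t ht] at h
    exact congrArg Prod.fst h
  have e2 : ∀ t ∈ Icc 0 T, (X t).2 = ∫ s in (0:ℝ)..t, S2 s (X s).1 (X s).2 := by
    intro t ht
    have h := hXeq t ht
    rw [hpair X hXc.continuousOn t ht] at h
    exact congrArg Prod.snd h
  have d1 : ∀ a ∈ Icc 0 T, ∀ b ∈ Icc 0 T, |(X a).1 - (X b).1| ≤ B1 * |a - b| := by
    intro a ha b hb
    rw [e1 a ha, e1 b hb, intervalIntegral.integral_interval_sub_left
      (i1 X hXc.continuousOn 0 h0mem a ha) (i1 X hXc.continuousOn 0 h0mem b hb)]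
    rw [← Real.norm_eq_abs]
    refine intervalIntegral.norm_integral_le_of_norm_le_const ?_
    intro s hs
    exact (E1 s (uIcc_subset_Icc hb ha (uIoc_subset_uIcc hs))).1 (X s)
  have d2 : ∀ a ∈ Icc 0 T, ∀ b ∈ Icc 0 T, |(X a).2 - (X b).2| ≤ B2 * |a - b| := by
    intro a ha b hb
    rw [e2 a ha, e2 b hb, intervalIntegral.integral_interval_sub_left
      (i2 X hXc.continuousOn 0 h0mem a ha) (i2 X hXc.continuousOn 0 h0mem b hb)]
    rw [← Real.norm_eq_abs]
    refine intervalIntegral.norm_integral_le_of_norm_le_const ?_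
    intro s hs
    exact (E2 s (uIcc_subset_Icc hb ha (uIoc_subset_uIcc hs))).1 (X s)
  have z1 : (X 0).1 = 0 := by rw [e1 0 h0mem]; simp
  have z2 : (X 0).2 = 0 := by rw [e2 0 h0mem]; simp
  refine ⟨fun t => (X t).1, fun t => (X t).2, ⟨⟨B1.toNNReal, ?_⟩, ⟨B2.toNNReal, ?_⟩, z1, z2,
    fun t ht => ⟨e1 t ht, e2 t ht⟩⟩, ?_, ?_⟩
  · refine LipschitzOnWith.of_dist_le_mul fun a ha b hb => ?_
    rw [Real.coe_toNNReal _ hB1]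
    exact d1 a ha b hb
  · refine LipschitzOnWith.of_dist_le_mul fun a ha b hb => ?_
    rw [Real.coe_toNNReal _ hB2]
    exact d2 a ha b hb
  · rintro Y1 Y2 ⟨⟨K1, hK1⟩, ⟨K2, hK2⟩, -, -, hY⟩ t ht
    have hYc : ContinuousOn (fun t => (Y1 t, Y2 t)) (Icc 0 T) :=
      hK1.continuousOn.prodMk hK2.continuousOn
    have := hXu (fun t => (Y1 t, Y2 t)) hYc (fun s hs => by
      rw [hpair _ hYc s hs]
      exact Prod.ext (hY s hs).1 (hY s hs).2) t ht
    exact ⟨congrArg Prod.fst this, congrArg Prod.snd this⟩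
  · intro t ht
    have h1 := d1 t ht 0 h0mem
    have h2 := d2 t ht 0 h0mem
    rw [z1, sub_zero, sub_zero, abs_of_nonneg ht.1] at h1
    rw [z2, sub_zero, sub_zero, abs_of_nonneg ht.1] at h2
    have h3 := ht.1
    simp only
    linarith

end NS3D
end
end

section
/- For any measurable f : [0,1] × 𝕋² → ℝ satisfying ∫_{𝕋²}∫₀¹ [y₁(1−y₁)|∂_{y₁}f|² + |∇_{y′}f|²/(y₁(1−y₁))] dy₁ dy′ < ∞, one has ∫_{𝕋²}∫₀¹ |f − f̄|² dy₁ dy′ ≤ (1/2)∫_{𝕋²}∫₀¹ y₁(1−y₁)|∂_{y₁}f|² dy₁ dy′ + (1/(16π²))∫_{𝕋²}∫₀¹ |∇_{y′}f|²/(y₁(1−y₁)) dy₁ dy′, where f̄ = ∫_{𝕋²}∫₀¹ f dy₁ dy′ is the average of f. -/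
noncomputable section
open MeasureTheory Set Filter Topology Real

namespace NS3D

variable {F : Type*} [NormedAddCommGroup F] [NormedSpace ℝ F]

def uM : Measure ℝ := volume.restrict (Icc (0:ℝ) 1)

instance : IsProbabilityMeasure uM := ⟨by simp [uM]⟩

def VV {α : Type*} [MeasurableSpace α] (μ : Measure α) (h : α → ℝ) : ℝ :=
  ∫ x, (h x)^2 ∂μ - (∫ x, h x ∂μ)^2

lemma uM_Ioc : uM = volume.restrict (Ioc (0:ℝ) 1) := by
  unfold uM; exact (restrict_Ioc_eq_restrict_Icc).symm

lemma wirtinger (h h' : ℝ → ℝ) (hd : ∀ x, HasDerivAt h (h' x) x) (hp : h 1 = h 0)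
    (hi : Integrable (fun x => (h' x)^2) uM) :
    VV uM h ≤ 1 / (4 * π^2) * ∫ x, (h' x)^2 ∂uM := by
  have hm : Measurable h' := by
    have : h' = deriv h := by ext x; exact (hd x).deriv.symm
    rw [this]; exact measurable_deriv h
  have hc : Continuous h := continuous_iff_continuousAt.2 fun x => (hd x).continuousAt
  have h01 : (0:ℝ) < 1 := one_pos
  have L1 : MemLp (fun x => (h' x : ℂ)) 2 (volume.restrict (Ioc (0:ℝ) 1)) := by
    rw [← uM_Ioc]
    exact ((memLp_two_iff_integrable_sq hm.aestronglyMeasurable).2 hi).ofReal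
  have L0 : MemLp (fun x => (h x : ℂ)) 2 (volume.restrict (Ioc (0:ℝ) 1)) := by
    have : MemLp h 2 (volume.restrict (Ioc (0:ℝ) 1)) := by
      rw [memLp_two_iff_integrable_sq hc.aestronglyMeasurable]
      have := ((hc.pow 2).intervalIntegrable (μ := volume) 0 1)
      rwa [intervalIntegrable_iff_integrableOn_Ioc_of_le h01.le] at this
    exact this.ofReal
  have S1 := hasSum_sq_fourierCoeffOn h01 L1
  have S0 := hasSum_sq_fourierCoeffOn h01 L0
  have hII : IntervalIntegrable (fun x => (h' x : ℂ)) volume 0 1 := by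
    rw [intervalIntegrable_iff_integrableOn_Ioc_of_le h01.le]
    exact L1.integrable one_le_two
  have key : ∀ n : ℤ, n ≠ 0 → ‖fourierCoeffOn h01 (fun x => (h x : ℂ)) n‖^2 ≤
      1 / (4 * π^2) * ‖fourierCoeffOn h01 (fun x => (h' x : ℂ)) n‖^2 := by
    intro n hn
    rw [fourierCoeffOn_of_hasDerivAt h01 hn (fun x _ => (hd x).ofReal_comp) hII]
    have hn1 : (1:ℝ) ≤ (n:ℝ)^2 := by
      have : (1:ℤ) ≤ n^2 := by have := sq_pos_of_ne_zero hn; omega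
      exact_mod_cast this
    simp only [hp, sub_self, mul_zero, Complex.ofReal_one, Complex.ofReal_zero, sub_zero, zero_sub, one_mul, norm_mul, norm_neg, mul_pow, norm_div, norm_one, div_pow, one_pow, Complex.norm_I]
    gcongr ?_ * _
    simp only [Complex.norm_real, Complex.norm_intCast, Real.norm_eq_abs, sq_abs, Complex.norm_ofNat]
    apply one_div_le_one_div_of_le (by positivity)
    nlinarith [sq_nonneg π, mul_le_mul_of_nonneg_left hn1 (sq_nonneg π)]
  have c0 : ‖fourierCoeffOn h01 (fun x => (h x : ℂ)) 0‖^2 = (∫ x, h x ∂uM)^2 := by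
    rw [fourierCoeffOn_eq_integral, uM_Ioc, ← intervalIntegral.integral_of_le h01.le]
    simp only [neg_zero, fourier_zero, one_smul, sub_zero, div_one]
    rw [intervalIntegral.integral_ofReal]; simp
  have S0' := S0.update 0 0
  have := hasSum_le (f := Function.update (fun i : ℤ => ‖fourierCoeffOn h01 (fun x => (h x : ℂ)) i‖^2) 0 0) (fun n => by
    by_cases hn : n = 0
    · subst hn; simp; positivity
    · simpa [hn] using key n hn) S0' (S1.mul_left (1 / (4 * π^2)))
  rw [c0, intervalIntegral.integral_of_le h01.le, intervalIntegral.integral_of_le h01.le, ← uM_Ioc] at this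
  simp only [Complex.norm_real, Real.norm_eq_abs, sq_abs, sub_zero, inv_one, one_smul] at this
  unfold VV
  linarith

lemma cs {α : Type*} [MeasurableSpace α] (μ : Measure α) [IsFiniteMeasure μ] (w : α → ℝ)
    (hw : Integrable w μ) (hw2 : Integrable (fun x => (w x)^2) μ) :
    (∫ x, w x ∂μ)^2 ≤ μ.real univ * ∫ x, (w x)^2 ∂μ := by
  set m := μ.real univ with hm
  set J := ∫ x, w x ∂μ
  have h0 : 0 ≤ ∫ x, (m * w x - J)^2 ∂μ := integral_nonneg fun x => sq_nonneg _
  have h1 : ∫ x, (m * w x - J)^2 ∂μ = m^2 * ∫ x, (w x)^2 ∂μ - 2 * m * J * J + J^2 * m := by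
    have : ∀ x, (m * w x - J)^2 = m^2 * (w x)^2 - 2*m*J * w x + J^2 := fun x => by ring
    simp only [this]
    rw [integral_add, integral_sub, integral_const_mul, integral_const_mul, integral_const, smul_eq_mul]
    · ring
    all_goals fun_prop
  have hm0 : 0 ≤ m := measureReal_nonneg
  rcases hm0.eq_or_lt with h | h
  · have : μ = 0 := by
      rw [hm, eq_comm, measureReal_eq_zero_iff] at h
      exact Measure.measure_univ_eq_zero.1 h
    have : J = 0 := by simp [J, this]
    rw [this, ← h]; simp
  · rw [h1] at h0
    have : 0 ≤ m * (m * ∫ x, (w x)^2 ∂μ - J^2) := by nlinarith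
    have := nonneg_of_mul_nonneg_right this h
    linarith

lemma bdd_int {α : Type*} [MeasurableSpace α] (μ : Measure α) [IsFiniteMeasure μ] (F : α → ℝ)
    (hF : StronglyMeasurable F) (C : ℝ) (hC : ∀ x, |F x| ≤ C) : Integrable F μ :=
  Integrable.of_bound hF.aestronglyMeasurable C (.of_forall hC)

lemma bdd_avg {α : Type*} [MeasurableSpace α] (μ : Measure α) [IsProbabilityMeasure μ] (F : α → ℝ)
    (C : ℝ) (hC : ∀ x, |F x| ≤ C) : |∫ x, F x ∂μ| ≤ C := by
  have := norm_integral_le_of_norm_le_const (μ := μ) (f := F) (C := C) (.of_forall hC)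
  simpa using this

lemma expand {α : Type*} [MeasurableSpace α] (μ : Measure α) [IsProbabilityMeasure μ]
    (F A B : α → ℝ) (m : ℝ)
    (iF : Integrable F μ) (iA : Integrable A μ) (iB : Integrable B μ)
    (iF2 : Integrable (fun p => F p ^ 2) μ) (iA2 : Integrable (fun p => A p ^ 2) μ)
    (iB2 : Integrable (fun p => B p ^ 2) μ) (iFA : Integrable (fun p => F p * A p) μ)
    (iFB : Integrable (fun p => F p * B p) μ) (iAB : Integrable (fun p => A p * B p) μ) :
    0 ≤ (∫ p, F p ^ 2 ∂μ) + (∫ p, A p ^ 2 ∂μ) + (∫ p, B p ^ 2 ∂μ) + 2 * (∫ p, A p * B p ∂μ)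
      + 2 * m * (∫ p, F p ∂μ) + m ^ 2 -
      (2 * (∫ p, F p * A p ∂μ) + 2 * (∫ p, F p * B p ∂μ) + 2 * m * (∫ p, A p ∂μ)
        + 2 * m * (∫ p, B p ∂μ)) := by
  have h0 : 0 ≤ ∫ p, (F p - A p - B p + m)^2 ∂μ :=
    integral_nonneg fun _ => sq_nonneg _
  have hexp : ∀ p, (F p - A p - B p + m)^2 =
     ((F p)^2 + A p^2 + B p^2 + 2 * (A p * B p) + 2 * m * F p + m^2) -
      (2 * (F p * A p) + 2 * (F p * B p) + 2 * m * A p + 2 * m * B p) := fun p => by ring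
  simp only [hexp] at h0
  rw [integral_sub (by fun_prop) (by fun_prop), integral_add (by fun_prop) (by fun_prop),
    integral_add (by fun_prop) (by fun_prop), integral_add (by fun_prop) (by fun_prop),
    integral_add (by fun_prop) (by fun_prop), integral_add (by fun_prop) (by fun_prop),
    integral_add (by fun_prop) (by fun_prop), integral_add (by fun_prop) (by fun_prop),
    integral_add (by fun_prop) (by fun_prop)] at h0
  simpa only [integral_const_mul, integral_const, probReal_univ, one_smul] using h0

lemma es {α β : Type*} [MeasurableSpace α] [MeasurableSpace β] (μ : Measure α) (ν : Measure β)
    [IsProbabilityMeasure μ] [IsProbabilityMeasure ν] (F : α × β → ℝ)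
    (hF : StronglyMeasurable F) (C : ℝ) (hC : ∀ x, |F x| ≤ C) :
    VV (μ.prod ν) F ≤ ∫ b, VV μ (fun a => F (a,b)) ∂ν + ∫ a, VV ν (fun b => F (a,b)) ∂μ := by
  set A : α → ℝ := fun a => ∫ b, F (a,b) ∂ν
  set B : β → ℝ := fun b => ∫ a, F (a,b) ∂μ
  have hAm : StronglyMeasurable A := hF.integral_prod_right'
  have hBm : StronglyMeasurable B := hF.integral_prod_left'
  have hAC : ∀ a, |A a| ≤ C := fun a => bdd_avg _ _ _ fun b => hC _
  have hBC : ∀ a, |B a| ≤ C := fun a => bdd_avg _ _ _ fun b => hC _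
  have sqb : ∀ {x : ℝ}, |x| ≤ C → |x^2| ≤ C^2 := fun {x} hx => by
    rw [abs_pow]; exact pow_le_pow_left₀ (abs_nonneg _) hx 2
  have mb : ∀ {x y : ℝ}, |x| ≤ C → |y| ≤ C → |x*y| ≤ C*C := fun {x y} hx hy => by
    rw [abs_mul]; exact mul_le_mul hx hy (abs_nonneg _) ((abs_nonneg _).trans hx)
  have iF : Integrable F (μ.prod ν) := bdd_int _ _ hF C hC
  have iF2 : Integrable (fun p => F p ^2) (μ.prod ν) := bdd_int _ _ (hF.pow 2) (C^2) fun p => sqb (hC p)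
  have iA : Integrable A μ := bdd_int _ _ hAm C hAC
  have iB : Integrable B ν := bdd_int _ _ hBm C hBC
  have iA2 : Integrable (fun a => A a^2) μ := bdd_int _ _ (hAm.pow 2) (C^2) fun p => sqb (hAC p)
  have iB2 : Integrable (fun a => B a^2) ν := bdd_int _ _ (hBm.pow 2) (C^2) fun p => sqb (hBC p)
  have hA1 : StronglyMeasurable fun p : α × β => A p.1 := hAm.comp_measurable measurable_fst
  have hB1 : StronglyMeasurable fun p : α × β => B p.2 := hBm.comp_measurable measurable_snd
  have jA : Integrable (fun p : α × β => A p.1) (μ.prod ν) := bdd_int _ _ hA1 C fun p => hAC _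
  have jB : Integrable (fun p : α × β => B p.2) (μ.prod ν) := bdd_int _ _ hB1 C fun p => hBC _
  have jA2 : Integrable (fun p : α × β => A p.1^2) (μ.prod ν) := bdd_int _ _ (hA1.pow 2) (C^2) fun p => sqb (hAC _)
  have jB2 : Integrable (fun p : α × β => B p.2^2) (μ.prod ν) := bdd_int _ _ (hB1.pow 2) (C^2) fun p => sqb (hBC _)
  have jFA : Integrable (fun p : α × β => F p * A p.1) (μ.prod ν) := bdd_int _ _ (hF.mul hA1) (C*C) fun p => mb (hC _) (hAC _)
  have jFB : Integrable (fun p : α × β => F p * B p.2) (μ.prod ν) := bdd_int _ _ (hF.mul hB1) (C*C) fun p => mb (hC _) (hBC _)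
  have jAB : Integrable (fun p : α × β => A p.1 * B p.2) (μ.prod ν) := bdd_int _ _ (hA1.mul hB1) (C*C) fun p => mb (hAC _) (hBC _)
  set m := ∫ p, F p ∂(μ.prod ν) with hm
  have eA : ∫ a, A a ∂μ = m := (integral_prod _ iF).symm
  have eB : ∫ a, B a ∂ν = m := (integral_prod_symm _ iF).symm
  set S := ∫ p, F p ^ 2 ∂(μ.prod ν) with hS
  have e1 : ∫ b, VV μ (fun a => F (a,b)) ∂ν = S - ∫ b, B b^2 ∂ν := by
    unfold VV
    rw [integral_sub iF2.integral_prod_right iB2, hS, integral_prod_symm _ iF2]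
  have e2 : ∫ a, VV ν (fun b => F (a,b)) ∂μ = S - ∫ a, A a^2 ∂μ := by
    unfold VV
    rw [integral_sub iF2.integral_prod_left iA2, hS, integral_prod _ iF2]
  have f1 : ∫ p, F p * A p.1 ∂(μ.prod ν) = ∫ a, A a^2 ∂μ := by
    rw [integral_prod _ jFA]
    congr 1; ext a; simp only [integral_mul_const]; rw [sq]
  have f2 : ∫ p, F p * B p.2 ∂(μ.prod ν) = ∫ a, B a^2 ∂ν := by
    rw [integral_prod_symm _ jFB]
    congr 1; ext a; simp only [integral_mul_const]; rw [sq]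
  have f3 : ∫ p : α × β, A p.1 * B p.2 ∂(μ.prod ν) = m * m := by
    rw [integral_prod_mul, eA, eB]
  have f4 : ∫ p : α × β, A p.1^2 ∂(μ.prod ν) = ∫ a, A a^2 ∂μ := by
    rw [integral_prod _ jA2]; simp
  have f5 : ∫ p : α × β, B p.2^2 ∂(μ.prod ν) = ∫ a, B a^2 ∂ν := by
    rw [integral_prod_symm _ jB2]; simp
  have f6 : ∫ p : α × β, A p.1 ∂(μ.prod ν) = m := by
    rw [integral_prod _ jA]; simpa using eA
  have f7 : ∫ p : α × β, B p.2 ∂(μ.prod ν) = m := by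
    rw [integral_prod_symm _ jB]; simpa using eB
  have h0 := expand (μ.prod ν) F (fun p => A p.1) (fun p => B p.2) m iF jA jB iF2 jA2 jB2 jFA jFB jAB
  simp only [f1, f2, f3, f4, f5, f6, f7, ← hm, ← hS] at h0
  rw [e1, e2]
  unfold VV
  rw [← hm, ← hS]
  nlinarith

/-- Kernel used in the weighted one-dimensional inequality. -/
def kk (x y t : ℝ) : ENNReal := if x < t ∧ t ≤ y then ENNReal.ofReal (y - x) else 0

lemma kk_meas : Measurable (fun p : (ℝ × ℝ) × ℝ => kk p.1.1 p.1.2 p.2) := by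
  unfold kk
  refine Measurable.ite ?_ (by fun_prop) (by fun_prop)
  have h1 : MeasurableSet {p : (ℝ × ℝ) × ℝ | p.1.1 < p.2} :=
    measurableSet_lt (by fun_prop) (by fun_prop)
  have h2 : MeasurableSet {p : (ℝ × ℝ) × ℝ | p.2 ≤ p.1.2} :=
    measurableSet_le (by fun_prop) (by fun_prop)
  exact h1.inter h2

lemma kk_int (t : ℝ) (ht : t ∈ Icc (0:ℝ) 1) :
    ∫⁻ x, ∫⁻ y, kk x y t ∂uM ∂uM = ENNReal.ofReal (t * (1 - t) / 2) := by
  have h1 : ∀ x, x < t → ∫⁻ y, kk x y t ∂uM = ENNReal.ofReal ((1 - t^2)/2 - x * (1-t)) := by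
    intro x hx
    have : ∀ y, kk x y t = (Ici t).indicator (fun y => ENNReal.ofReal (y - x)) y := by
      intro y; simp [kk, indicator, hx]
    simp only [this]
    rw [lintegral_indicator measurableSet_Ici, uM, Measure.restrict_restrict measurableSet_Ici]
    have hs : Ici t ∩ Icc 0 1 = Icc t 1 := by
      ext y; simp only [mem_inter_iff, mem_Ici, mem_Icc]; constructor
      · rintro ⟨a, b, c⟩; exact ⟨a, c⟩
      · rintro ⟨a, c⟩; exact ⟨a, ht.1.trans a, c⟩
    rw [hs, ← ofReal_integral_eq_lintegral_ofReal]
    · congr 1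
      rw [integral_Icc_eq_integral_Ioc, ← intervalIntegral.integral_of_le ht.2]
      rw [intervalIntegral.integral_sub (Continuous.intervalIntegrable (by fun_prop) _ _) (Continuous.intervalIntegrable (by fun_prop) _ _)]
      simp; ring
    · exact (by fun_prop : Continuous fun y : ℝ => y - x).continuousOn.integrableOn_compact isCompact_Icc
    · filter_upwards [ae_restrict_mem measurableSet_Icc] with y hy
      simp only [Pi.zero_apply]; linarith [hy.1]
  have h2 : ∀ x, ∫⁻ y, kk x y t ∂uM =
      (Iio t).indicator (fun x => ENNReal.ofReal ((1 - t^2)/2 - x * (1-t))) x := by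
    intro x
    by_cases hx : x < t
    · rw [h1 x hx]; simp [indicator, hx]
    · simp [kk, hx, indicator]
  simp only [h2]
  rw [lintegral_indicator measurableSet_Iio, uM, Measure.restrict_restrict measurableSet_Iio]
  have hs : Iio t ∩ Icc 0 1 = Ico 0 t := by
    ext y; simp only [mem_inter_iff, mem_Iio, mem_Icc, mem_Ico]; constructor
    · rintro ⟨a, b, c⟩; exact ⟨b, a⟩
    · rintro ⟨a, c⟩; exact ⟨c, a, c.le.trans ht.2⟩
  rw [hs, restrict_Ico_eq_restrict_Icc, ← ofReal_integral_eq_lintegral_ofReal]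
  · congr 1
    rw [integral_Icc_eq_integral_Ioc, ← intervalIntegral.integral_of_le ht.1]
    rw [intervalIntegral.integral_sub (Continuous.intervalIntegrable (by fun_prop) _ _) (Continuous.intervalIntegrable (by fun_prop) _ _)]
    simp; ring
  · exact (by fun_prop : Continuous fun x : ℝ => (1 - t^2)/2 - x * (1-t)).continuousOn.integrableOn_compact isCompact_Icc
  · filter_upwards [ae_restrict_mem measurableSet_Icc] with y hy
    simp only [Pi.zero_apply]
    nlinarith [hy.1, hy.2, ht.1, ht.2, mul_nonneg (sub_nonneg.2 hy.2) (sub_nonneg.2 ht.2)]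

lemma hardy_point (h h' : ℝ → ℝ) (hd : ∀ x, HasDerivAt h (h' x) x)
    (hi : Integrable (fun x => x * (1 - x) * (h' x)^2) uM) (x y : ℝ) (hx : 0 < x) (hxy : x < y)
    (hy : y < 1) :
    ENNReal.ofReal ((h x - h y)^2) ≤ ∫⁻ t, kk x y t * ENNReal.ofReal ((h' t)^2) ∂uM := by
  have hm : Measurable h' := by
    have : h' = deriv h := by ext x; exact (hd x).deriv.symm
    rw [this]; exact measurable_deriv h
  have hsub : Ioc x y ⊆ Icc 0 1 := fun t ht => ⟨hx.le.trans ht.1.le, ht.2.trans hy.le⟩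
  have i2 : IntegrableOn (fun t => (h' t)^2) (Ioc x y) := by
    have hi' : IntegrableOn (fun x => x * (1 - x) * (h' x)^2) (Ioc x y) :=
      IntegrableOn.mono_set hi hsub
    refine Integrable.mono' (hi'.const_mul (1 / (x * (1 - y)))) (by fun_prop) ?_
    filter_upwards [ae_restrict_mem measurableSet_Ioc] with t ht
    have hp : 0 < x * (1 - y) := mul_pos hx (by linarith)
    rw [Real.norm_eq_abs, abs_of_nonneg (sq_nonneg _), ← mul_assoc]
    apply le_mul_of_one_le_left (sq_nonneg _)
    rw [one_div, ← div_eq_inv_mul, one_le_div hp]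
    have := ht.1; have := ht.2
    apply mul_le_mul <;> linarith
  have i1 : IntegrableOn h' (Ioc x y) :=
    ((memLp_two_iff_integrable_sq hm.aestronglyMeasurable).2 i2).integrable one_le_two
  have ftc : ∫ t in Ioc x y, h' t = h y - h x := by
    rw [← intervalIntegral.integral_of_le hxy.le]
    exact intervalIntegral.integral_eq_sub_of_hasDerivAt (fun t _ => hd t)
      ((intervalIntegrable_iff_integrableOn_Ioc_of_le hxy.le).2 i1)
  have hcs := cs (volume.restrict (Ioc x y)) h' i1 i2
  rw [ftc] at hcs
  have hvol : (volume.restrict (Ioc x y)).real univ = y - x := by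
    simp [measureReal_restrict_apply, hxy.le]
  rw [hvol] at hcs
  have hR : ∫⁻ t, kk x y t * ENNReal.ofReal ((h' t)^2) ∂uM
      = ENNReal.ofReal (y - x) * ∫⁻ t in Ioc x y, ENNReal.ofReal ((h' t)^2) := by
    have : ∀ t, kk x y t * ENNReal.ofReal ((h' t)^2) =
      (Ioc x y).indicator (fun t => ENNReal.ofReal (y - x) * ENNReal.ofReal ((h' t)^2)) t := by
      intro t; by_cases ht : x < t ∧ t ≤ y <;> simp [kk, indicator, ht]
    simp only [this]
    rw [lintegral_indicator measurableSet_Ioc, uM, Measure.restrict_restrict measurableSet_Ioc,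
      inter_eq_left.2 hsub, lintegral_const_mul _ (by fun_prop)]
  rw [hR, ← ofReal_integral_eq_lintegral_ofReal i2 (.of_forall fun _ => sq_nonneg _),
    ← ENNReal.ofReal_mul (by linarith)]
  apply ENNReal.ofReal_le_ofReal
  nlinarith

lemma uM_Ioo : ∀ᵐ x ∂uM, x ∈ Ioo (0:ℝ) 1 := by
  rw [uM, ← restrict_Ioo_eq_restrict_Icc]
  exact ae_restrict_mem measurableSet_Ioo

lemma uM_cont_int (h : ℝ → ℝ) (hc : Continuous h) : Integrable h uM :=
  hc.continuousOn.integrableOn_compact isCompact_Icc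

lemma hardy (h h' : ℝ → ℝ) (hd : ∀ x, HasDerivAt h (h' x) x)
    (hi : Integrable (fun x => x * (1 - x) * (h' x)^2) uM) :
    VV uM h ≤ 1 / 2 * ∫ x, x * (1 - x) * (h' x)^2 ∂uM := by
  have hm : Measurable h' := by
    have : h' = deriv h := by ext x; exact (hd x).deriv.symm
    rw [this]; exact measurable_deriv h
  have hc : Continuous h := continuous_iff_continuousAt.2 fun x => (hd x).continuousAt
  have i1 := uM_cont_int h hc
  have i2 := uM_cont_int (fun x => (h x)^2) (hc.pow 2)
  have j1 : Integrable (fun p : ℝ × ℝ => (h p.1)^2) (uM.prod uM) := i2.comp_fst uM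
  have j2 : Integrable (fun p : ℝ × ℝ => (h p.2)^2) (uM.prod uM) := i2.comp_snd uM
  have j3 : Integrable (fun p : ℝ × ℝ => h p.1 * h p.2) (uM.prod uM) := i1.mul_prod i1
  have hexp : ∀ p : ℝ × ℝ, (h p.1 - h p.2)^2 = (h p.1)^2 + (h p.2)^2 - 2 * (h p.1 * h p.2) :=
    fun p => by ring
  have j4 : Integrable (fun p : ℝ × ℝ => (h p.1 - h p.2)^2) (uM.prod uM) := by
    simp only [hexp]; exact (j1.add j2).sub (j3.const_mul 2)
  have e1 : ∫ p : ℝ × ℝ, (h p.1 - h p.2)^2 ∂(uM.prod uM) = 2 * VV uM h := by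
    simp only [hexp]
    rw [integral_sub (by exact j1.add j2) (j3.const_mul 2), integral_add j1 j2, integral_const_mul,
      integral_prod_mul, integral_prod _ j1, integral_prod_symm _ j2]
    simp [VV]; ring
  have hg : Measurable fun t => ENNReal.ofReal ((h' t)^2) := by fun_prop
  have hK : Measurable fun q : (ℝ × ℝ) × ℝ => kk q.1.1 q.1.2 q.2 * ENNReal.ofReal ((h' q.2)^2) :=
    kk_meas.mul (hg.comp measurable_snd)
  have e2 : ∫⁻ p : ℝ × ℝ, ENNReal.ofReal ((h p.1 - h p.2)^2) ∂(uM.prod uM) ≤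
      ∫⁻ p : ℝ × ℝ, ((∫⁻ t, kk p.1 p.2 t * ENNReal.ofReal ((h' t)^2) ∂uM)
       + ∫⁻ t, kk p.2 p.1 t * ENNReal.ofReal ((h' t)^2) ∂uM) ∂(uM.prod uM) := by
    apply lintegral_mono_ae
    have a1 : ∀ᵐ p ∂(uM.prod uM), p.1 ∈ Ioo (0:ℝ) 1 :=
      Measure.quasiMeasurePreserving_fst.ae uM_Ioo
    have a2 : ∀ᵐ p ∂(uM.prod uM), p.2 ∈ Ioo (0:ℝ) 1 :=
      Measure.quasiMeasurePreserving_snd.ae uM_Ioo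
    filter_upwards [a1, a2] with p h1 h2
    rcases lt_trichotomy p.1 p.2 with hl | hl | hl
    · exact (hardy_point h h' hd hi _ _ h1.1 hl h2.2).trans le_self_add
    · rw [hl]; simp
    · rw [show (h p.1 - h p.2)^2 = (h p.2 - h p.1)^2 by ring]
      exact (hardy_point h h' hd hi _ _ h2.1 hl h1.2).trans le_add_self
  have e3 : ∫⁻ p : ℝ × ℝ, (∫⁻ t, kk p.1 p.2 t * ENNReal.ofReal ((h' t)^2) ∂uM) ∂(uM.prod uM)
      = ENNReal.ofReal (∫ x, 1 / 2 * (x * (1 - x) * (h' x)^2) ∂uM) := by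
    rw [lintegral_lintegral_swap hK.aemeasurable, ofReal_integral_eq_lintegral_ofReal (hi.const_mul _)]
    · apply lintegral_congr_ae
      filter_upwards [uM_Ioo] with t ht
      have mk : Measurable fun p : ℝ × ℝ => kk p.1 p.2 t := kk_meas.comp (by fun_prop : Measurable fun p : ℝ × ℝ => (p, t))
      rw [lintegral_mul_const _ mk, lintegral_prod _ mk.aemeasurable,
        kk_int t ⟨ht.1.le, ht.2.le⟩, ← ENNReal.ofReal_mul (by nlinarith [ht.1, ht.2])]
      congr 1; ring
    · filter_upwards [uM_Ioo] with t ht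
      have := mul_nonneg ht.1.le (sub_nonneg.2 ht.2.le)
      simp only [Pi.zero_apply]; positivity
  have e4 : ∫⁻ p : ℝ × ℝ, (∫⁻ t, kk p.2 p.1 t * ENNReal.ofReal ((h' t)^2) ∂uM) ∂(uM.prod uM)
      = ENNReal.ofReal (∫ x, 1 / 2 * (x * (1 - x) * (h' x)^2) ∂uM) := by
    rw [← e3]
    exact lintegral_prod_swap (μ := uM) (ν := uM) (fun p : ℝ × ℝ => ∫⁻ t, kk p.1 p.2 t * ENNReal.ofReal ((h' t)^2) ∂uM)
  rw [lintegral_add_left hK.lintegral_prod_right', e3, e4,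
    ← ofReal_integral_eq_lintegral_ofReal j4 (.of_forall fun _ => sq_nonneg _), e1] at e2
  have hn : 0 ≤ ∫ x, 1 / 2 * (x * (1 - x) * (h' x)^2) ∂uM := by
    apply integral_nonneg_of_ae
    filter_upwards [uM_Ioo] with t ht
    have := mul_nonneg ht.1.le (sub_nonneg.2 ht.2.le)
    simp only [Pi.zero_apply]; positivity
  rw [← ENNReal.ofReal_add hn hn, ENNReal.ofReal_le_ofReal_iff (by linarith), integral_const_mul] at e2
  linarith

lemma VV_congr {α : Type*} [MeasurableSpace α] (μ : Measure α) (F G : α → ℝ) (h : F =ᵐ[μ] G) :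
    VV μ F = VV μ G := by
  unfold VV
  have h2 : ∫ x, F x ^ 2 ∂μ = ∫ x, G x ^ 2 ∂μ :=
    integral_congr_ae (by filter_upwards [h] with x hx; rw [hx])
  rw [integral_congr_ae h, h2]

lemma VV_nonneg {α : Type*} [MeasurableSpace α] (μ : Measure α) [IsProbabilityMeasure μ]
    (F : α → ℝ) (hF : StronglyMeasurable F) (C : ℝ) (hC : ∀ x, |F x| ≤ C) : 0 ≤ VV μ F := by
  have := cs μ F (bdd_int _ _ hF C hC) (bdd_int _ _ (hF.pow 2) (C^2) fun x => by
    rw [abs_pow]; exact pow_le_pow_left₀ (abs_nonneg _) (hC x) 2)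
  simp only [probReal_univ, one_mul] at this
  unfold VV; linarith

lemma VV_eq {α : Type*} [MeasurableSpace α] (μ : Measure α) [IsProbabilityMeasure μ]
    (F : α → ℝ) (h1 : Integrable F μ) (h2 : Integrable (fun x => F x^2) μ) :
    ∫ x, (F x - ∫ z, F z ∂μ)^2 ∂μ = VV μ F := by
  set m := ∫ z, F z ∂μ with hm
  have : ∀ x, (F x - m)^2 = F x^2 - 2 * m * F x + m^2 := fun x => by ring
  simp only [this]
  rw [integral_add (by fun_prop) (by fun_prop), integral_sub (by fun_prop) (by fun_prop),
    integral_const_mul, integral_const, ← hm]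
  simp [VV, ← hm]; ring

lemma uM_Icc : ∀ᵐ x ∂uM, x ∈ Icc (0:ℝ) 1 := ae_restrict_mem measurableSet_Icc

lemma wirt2 (G g u v : ℝ × ℝ → ℝ) (hG : StronglyMeasurable G) (C : ℝ) (hC : ∀ x, |G x| ≤ C)
    (hGg : ∀ b ∈ Icc (0:ℝ) 1, ∀ c ∈ Icc (0:ℝ) 1, G (b, c) = g (b, c))
    (hu : ∀ b c, HasDerivAt (fun b => g (b, c)) (u (b, c)) b)
    (hv : ∀ b c, HasDerivAt (fun c => g (b, c)) (v (b, c)) c)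
    (pu : ∀ c, g (1, c) = g (0, c)) (pv : ∀ b, g (b, 1) = g (b, 0))
    (iu : Integrable (fun p => u p ^ 2) (uM.prod uM))
    (iv : Integrable (fun p => v p ^ 2) (uM.prod uM)) :
    VV (uM.prod uM) G ≤ 1 / (4 * π^2) * ∫ p, (u p ^ 2 + v p ^ 2) ∂(uM.prod uM) := by
  refine (es uM uM G hG C hC).trans ?_
  rw [integral_add iu iv, mul_add]
  apply add_le_add
  · rw [integral_prod_symm _ iu, ← integral_const_mul]
    apply integral_mono_of_nonneg
    · exact .of_forall fun c => VV_nonneg _ _ (hG.comp_measurable measurable_prodMk_right) C fun _ => hC _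
    · exact iu.integral_prod_right.const_mul _
    · filter_upwards [uM_Icc, iu.prod_left_ae] with c hc hic
      rw [VV_congr uM (fun b => G (b, c)) (fun b => g (b, c))]
      · exact wirtinger _ _ (fun b => hu b c) (pu c) hic
      · filter_upwards [uM_Icc] with b hb using hGg b hb c hc
  · rw [integral_prod _ iv, ← integral_const_mul]
    apply integral_mono_of_nonneg
    · exact .of_forall fun c => VV_nonneg _ _ (hG.comp_measurable measurable_prodMk_left) C fun _ => hC _
    · exact iv.integral_prod_left.const_mul _
    · filter_upwards [uM_Icc, iv.prod_right_ae] with b hb hib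
      rw [VV_congr uM (fun c => G (b, c)) (fun c => g (b, c))]
      · exact wirtinger _ _ (fun c => hv b c) (pv b) hib
      · filter_upwards [uM_Icc] with c hc using hGg b hb c hc

/-- Coordinates on `Spc`. -/
def TT (p : ℝ × ℝ × ℝ) : Spc := p.1 • e 0 + p.2.1 • e 1 + p.2.2 • e 2

lemma TT0 (p : ℝ × ℝ × ℝ) : TT p 0 = p.1 := by simp [TT, e]
lemma TT1 (p : ℝ × ℝ × ℝ) : TT p 1 = p.2.1 := by simp [TT, e]
lemma TT2 (p : ℝ × ℝ × ℝ) : TT p 2 = p.2.2 := by simp [TT, e]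

/-- Coordinates on `Spc` as a measurable equivalence. -/
def TE : ℝ × ℝ × ℝ ≃ᵐ Spc :=
  ((MeasurableEquiv.refl ℝ).prodCongr (MeasurableEquiv.finTwoArrow (α := ℝ)).symm).trans
    ((MeasurableEquiv.piFinSuccAbove (fun _ : Fin 3 => ℝ) 0).symm.trans
      (MeasurableEquiv.toLp 2 (Fin 3 → ℝ)))

lemma TE_eq : ⇑TE = TT := by
  ext p i
  fin_cases i
  · exact (TT0 p).symm
  · exact (TT1 p).symm
  · exact (TT2 p).symm

lemma TE_mp : MeasurePreserving TE volume volume := by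
  have h1 : MeasurePreserving ((MeasurableEquiv.refl ℝ).prodCongr (MeasurableEquiv.finTwoArrow (α := ℝ)).symm) volume volume :=
    (MeasurePreserving.id volume).prod ((volume_preserving_finTwoArrow ℝ).symm _)
  have h2 := ((volume_preserving_piFinSuccAbove (fun _ : Fin 3 => ℝ) 0).symm _)
  exact ((PiLp.volume_preserving_toLp (Fin 3)).comp h2).comp h1

lemma TT_mp : MeasurePreserving TT (uM.prod (uM.prod uM)) (volume.restrict cube) := by
  have h := TE_mp.restrict_preimage_emb TE.measurableEmbedding cube
  rw [TE_eq] at h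
  have : TT ⁻¹' cube = Icc (0:ℝ) 1 ×ˢ (Icc (0:ℝ) 1 ×ˢ Icc (0:ℝ) 1) := by
    ext p; simp only [cube, TT0, TT1, TT2, mem_preimage, mem_ofPred_eq, mem_prod]
  rw [this] at h
  unfold uM
  rw [Measure.prod_restrict, Measure.prod_restrict]
  exact h

lemma TT_emb : MeasurableEmbedding TT := TE_eq ▸ TE.measurableEmbedding

lemma TT_cont : Continuous TT := by unfold TT; fun_prop

/-- Lemma 3.4, Poincaré-type inequality on `[0,1] × 𝕋²`.
The domain `[0,1] × 𝕋²` is modelled by the unit cube in `ℝ³` together with functions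
that are periodic (period 1) in the two transversal directions `y₂, y₃`;
`∂_{y₁} f = fderiv f (e 0)` and `∇_{y'} f = (fderiv f (e 1), fderiv f (e 2))`. -/
theorem poincare_type_inequality
    (f : Spc → ℝ)
    (hdiff : Differentiable ℝ f)
    (hper : PeriodicTD f)
    (hint : IntegrableOn f cube volume)
    (hint2 : IntegrableOn (fun y => (f y)^2) cube volume)
    (hfin1 : IntegrableOn
      (fun y => y 0 * (1 - y 0) * (fderiv ℝ f y (e 0))^2) cube volume)
    (hfin2 : IntegrableOn
      (fun y => ((fderiv ℝ f y (e 1))^2 + (fderiv ℝ f y (e 2))^2) / (y 0 * (1 - y 0)))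
      cube volume) :
    (∫ y in cube, (f y - ∫ z in cube, f z)^2)
      ≤ (1/2) * (∫ y in cube, y 0 * (1 - y 0) * (fderiv ℝ f y (e 0))^2)
        + (1 / (16 * Real.pi^2)) *
          (∫ y in cube, ((fderiv ℝ f y (e 1))^2 + (fderiv ℝ f y (e 2))^2)
            / (y 0 * (1 - y 0))) := by
  have hfc : Continuous f := hdiff.continuous
  obtain ⟨C, hC⟩ : ∃ C, ∀ p ∈ Icc (0:ℝ) 1 ×ˢ (Icc (0:ℝ) 1 ×ˢ Icc (0:ℝ) 1), ‖f (TT p)‖ ≤ C :=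
    (isCompact_Icc.prod (isCompact_Icc.prod isCompact_Icc)).exists_bound_of_continuousOn
      (hfc.comp TT_cont).continuousOn
  have hC0 : 0 ≤ C := (norm_nonneg _).trans (hC (0, 0, 0) (by simp))
  set G : ℝ × ℝ × ℝ → ℝ := fun p => max (-C) (min C (f (TT p))) with hGdef
  have hGm : StronglyMeasurable G :=
    (continuous_const.max (continuous_const.min (hfc.comp TT_cont))).stronglyMeasurable
  have hGC : ∀ p, |G p| ≤ C := fun p =>
    abs_le.2 ⟨le_max_left _ _, max_le (by linarith) (min_le_left _ _)⟩
  have hGf : ∀ a ∈ Icc (0:ℝ) 1, ∀ b ∈ Icc (0:ℝ) 1, ∀ c ∈ Icc (0:ℝ) 1,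
      G (a, b, c) = f (TT (a, b, c)) := by
    intro a ha b hb c hc
    have := abs_le.1 (hC (a, b, c) ⟨ha, hb, hc⟩)
    simp only [hGdef]
    rw [min_eq_right this.2, max_eq_right this.1]
  have iprob : IsProbabilityMeasure (volume.restrict cube) := by
    rw [← TT_mp.map_eq]
    exact Measure.isProbabilityMeasure_map TT_mp.measurable.aemeasurable
  set P := uM.prod (uM.prod uM) with hP
  have aeI2 : ∀ᵐ p ∂(uM.prod uM), p.1 ∈ Icc (0:ℝ) 1 ∧ p.2 ∈ Icc (0:ℝ) 1 :=
    (Measure.quasiMeasurePreserving_fst.ae uM_Icc).and (Measure.quasiMeasurePreserving_snd.ae uM_Icc)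
  have aeI3 : ∀ᵐ p ∂P, p.1 ∈ Icc (0:ℝ) 1 ∧ p.2.1 ∈ Icc (0:ℝ) 1 ∧ p.2.2 ∈ Icc (0:ℝ) 1 :=
    (Measure.quasiMeasurePreserving_fst.ae uM_Icc).and (Measure.quasiMeasurePreserving_snd.ae aeI2)
  have hL : ∫ y in cube, (f y - ∫ z in cube, f z)^2 = VV P G := by
    rw [VV_eq _ f hint hint2]
    have : VV P G = VV P (fun p => f (TT p)) := VV_congr _ _ _ (by
      filter_upwards [aeI3] with p hp using hGf _ hp.1 _ hp.2.1 _ hp.2.2)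
    rw [this]
    unfold VV
    rw [← TT_mp.integral_comp TT_emb, ← TT_mp.integral_comp TT_emb]
  set w : Fin 3 → ℝ × ℝ × ℝ → ℝ := fun i p => fderiv ℝ f (TT p) (e i) with hw
  have hwm : ∀ i, Measurable (w i) := fun i =>
    (measurable_fderiv_apply_const ℝ f (e i)).comp TT_cont.measurable
  have F1 : Integrable (fun p : ℝ × ℝ × ℝ => p.1 * (1 - p.1) * (w 0 p)^2) P := by
    have := (TT_mp.integrable_comp_emb TT_emb).2 hfin1
    simpa only [Function.comp_def, TT0] using this
  have F2 : Integrable (fun p : ℝ × ℝ × ℝ => ((w 1 p)^2 + (w 2 p)^2) / (p.1 * (1 - p.1))) P := by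
    have := (TT_mp.integrable_comp_emb TT_emb).2 hfin2
    simpa only [Function.comp_def, TT0] using this
  have d0 : ∀ a b c, HasDerivAt (fun a => f (TT (a, b, c))) (w 0 (a, b, c)) a := by
    intro a b c
    have h1 : HasDerivAt (fun a => TT (a, b, c)) (e 0) a := by
      simpa [TT] using (((hasDerivAt_id a).smul_const (e 0)).add_const (b • e 1)).add_const (c • e 2)
    exact (hdiff _).hasFDerivAt.comp_hasDerivAt a h1
  have d1 : ∀ a b c, HasDerivAt (fun b => f (TT (a, b, c))) (w 1 (a, b, c)) b := by
    intro a b c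
    have h1 : HasDerivAt (fun b => TT (a, b, c)) (e 1) b := by
      simpa [TT] using (((hasDerivAt_id b).smul_const (e 1)).const_add (a • e 0)).add_const (c • e 2)
    exact (hdiff _).hasFDerivAt.comp_hasDerivAt b h1
  have d2 : ∀ a b c, HasDerivAt (fun c => f (TT (a, b, c))) (w 2 (a, b, c)) c := by
    intro a b c
    have h1 : HasDerivAt (fun c => TT (a, b, c)) (e 2) c := by
      simpa [TT] using ((hasDerivAt_id c).smul_const (e 2)).const_add (a • e 0 + b • e 1)
    exact (hdiff _).hasFDerivAt.comp_hasDerivAt c h1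
  have p1 : ∀ a c, f (TT (a, 1, c)) = f (TT (a, 0, c)) := by
    intro a c
    rw [← (hper (TT (a, 0, c))).1]; congr 1; simp [TT]; abel
  have p2 : ∀ a b, f (TT (a, b, 1)) = f (TT (a, b, 0)) := by
    intro a b
    rw [← (hper (TT (a, b, 0))).2]; congr 1; simp [TT]
  rw [hL, ← TT_mp.integral_comp TT_emb, ← TT_mp.integral_comp TT_emb]
  simp only [TT0]
  change _ ≤ 1 / 2 * (∫ p : ℝ × ℝ × ℝ, p.1 * (1 - p.1) * (w 0 p)^2 ∂P) +
    1 / (16 * π^2) * (∫ p : ℝ × ℝ × ℝ, ((w 1 p)^2 + (w 2 p)^2) / (p.1 * (1 - p.1)) ∂P)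
  refine (es uM (uM.prod uM) G hGm C hGC).trans ?_
  apply add_le_add
  · rw [integral_prod_symm _ F1, ← integral_const_mul]
    apply integral_mono_of_nonneg
    · exact .of_forall fun c => VV_nonneg _ _ (hGm.comp_measurable measurable_prodMk_right) C fun _ => hGC _
    · exact F1.integral_prod_right.const_mul _
    · filter_upwards [aeI2, F1.prod_left_ae] with q hq hiq
      rw [VV_congr uM (fun a => G (a, q)) (fun a => f (TT (a, q)))]
      · exact hardy _ _ (fun a => d0 a q.1 q.2) hiq
      · filter_upwards [uM_Icc] with a ha using hGf a ha _ hq.1 _ hq.2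
  · rw [integral_prod _ F2, ← integral_const_mul]
    apply integral_mono_of_nonneg
    · exact .of_forall fun c => VV_nonneg _ _ (hGm.comp_measurable measurable_prodMk_left) C fun _ => hGC _
    · exact F2.integral_prod_left.const_mul _
    · filter_upwards [uM_Ioo, F2.prod_right_ae] with a ha hia
      have hpos : 0 < a * (1 - a) := mul_pos ha.1 (sub_pos.2 ha.2)
      have isum : Integrable (fun q : ℝ × ℝ => w 1 (a, q)^2 + w 2 (a, q)^2) (uM.prod uM) := by
        have := hia.mul_const (a * (1 - a))
        simpa only [div_mul_cancel₀ _ hpos.ne'] using this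
      have iu : Integrable (fun q : ℝ × ℝ => w 1 (a, q)^2) (uM.prod uM) := by
        refine isum.mono' (((hwm 1).comp measurable_prodMk_left).pow_const 2).aestronglyMeasurable (.of_forall fun q => ?_)
        rw [Real.norm_eq_abs, abs_of_nonneg (sq_nonneg _)]
        linarith [sq_nonneg (w 2 (a, q))]
      have iv : Integrable (fun q : ℝ × ℝ => w 2 (a, q)^2) (uM.prod uM) := by
        refine isum.mono' (((hwm 2).comp measurable_prodMk_left).pow_const 2).aestronglyMeasurable (.of_forall fun q => ?_)
        rw [Real.norm_eq_abs, abs_of_nonneg (sq_nonneg _)]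
        linarith [sq_nonneg (w 1 (a, q))]
      have := wirt2 (fun q => G (a, q)) (fun q => f (TT (a, q))) (fun q => w 1 (a, q)) (fun q => w 2 (a, q))
        (hGm.comp_measurable measurable_prodMk_left) C (fun _ => hGC _)
        (hGf a ⟨ha.1.le, ha.2.le⟩) (d1 a) (d2 a) (p1 a) (p2 a) iu iv
      refine this.trans ?_
      rw [integral_div]
      have hI : 0 ≤ ∫ q : ℝ × ℝ, (w 1 (a, q)^2 + w 2 (a, q)^2) ∂(uM.prod uM) :=
        integral_nonneg fun q => by positivity
      rw [← mul_div_assoc, le_div_iff₀ hpos]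
      have h4 : a * (1 - a) ≤ 1 / 4 := by nlinarith [sq_nonneg (a - 1/2)]
      have hA : 0 ≤ 1 / (4 * π^2) * ∫ q : ℝ × ℝ, (w 1 (a, q)^2 + w 2 (a, q)^2) ∂(uM.prod uM) := by positivity
      refine (mul_le_mul_of_nonneg_left h4 hA).trans (le_of_eq ?_)
      field_simp; ring

end NS3D
end
end
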